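/- For every integer d ≥ 4 and every vector ω₀ ∈ ℝ^d there exist a C^∞ function H : ℝ^{2d} → ℝ with H(x,y) = ⟨ω₀, r(x,y)⟩ + O³(x,y) (i.e. H − ⟨ω₀, r⟩ vanishes at the origin together with its first and second total derivatives) and a global flow Φ of X_H such that there is NO nonempty compact set K ⊆ ℝ^{2d} satisfying K ∩ ⋃_{i≤d}{r_i = 0} = ∅ and Φ(t,K) ⊆ K for all t ∈ ℝ; in particular Φ has no invariant torus of dimension d disjoint from the axes {r_i = 0}. -/

import Mathlib

open Filter Topology Metric Set

noncomputable section

/-- Phase space `ℝ^d × ℝ^d`, a point is `p = (x, y)`. -/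
abbrev Ph (d : ℕ) := (Fin d → ℝ) × (Fin d → ℝ)

/-- Action coordinates `r_j(p) = (x_j² + y_j²)/2`. -/
def actJ {d : ℕ} (j : Fin d) (p : Ph d) : ℝ := (p.1 j ^ 2 + p.2 j ^ 2) / 2

/-- The Hamiltonian vector field `X_H = (∂H/∂y, -∂H/∂x)`. -/
def hamVF {d : ℕ} (H : Ph d → ℝ) (p : Ph d) : Ph d :=
  (fun j => fderiv ℝ H p (0, Pi.single j 1),
   fun j => - fderiv ℝ H p (Pi.single j 1, 0))

/-- `Φ` is a global flow of the Hamiltonian vector field `X_H`. -/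
def IsGlobalFlow {d : ℕ} (H : Ph d → ℝ) (Φ : ℝ → Ph d → Ph d) : Prop :=
  (∀ p, Φ 0 p = p) ∧ (∀ s t p, Φ (s + t) p = Φ s (Φ t p)) ∧
  (∀ p t, HasDerivAt (fun τ => Φ τ p) (hamVF H (Φ t p)) t)

/-- `H(x,y) = ⟨ω, r(x,y)⟩ + O³(x,y)`: the difference `H - ⟨ω, r⟩` vanishes at the
origin together with its first and second total derivatives. -/
def IsEllipticNF {d : ℕ} (ω : Fin d → ℝ) (H : Ph d → ℝ) : Prop :=
  ∀ k ≤ 2, iteratedFDeriv ℝ k (fun p => H p - ∑ j, ω j * actJ j p) 0 = 0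

/-- The standard symplectic form on phase space. -/
def symForm {d : ℕ} (u v : Ph d) : ℝ := ∑ i, (u.1 i * v.2 i - u.2 i * v.1 i)

/-- The isomorphism from covectors to vectors induced by the symplectic form. -/
def symGrad {d : ℕ} : (Ph d →L[ℝ] ℝ) →L[ℝ] Ph d :=
  (ContinuousLinearMap.pi fun j =>
    ContinuousLinearMap.apply ℝ ℝ ((0, Pi.single j 1) : Ph d)).prod
  (ContinuousLinearMap.pi fun j =>
    -ContinuousLinearMap.apply ℝ ℝ ((Pi.single j 1, 0) : Ph d))

theorem hamVF_eq_symGrad {d : ℕ} (H : Ph d → ℝ) (p : Ph d) :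
    hamVF H p = symGrad (fderiv ℝ H p) := by
  simp only [hamVF, symGrad, ContinuousLinearMap.prod_apply]
  rfl

theorem symForm_single_right {d : ℕ} (u : Ph d) (j : Fin d) :
    symForm u (0, Pi.single j 1) = u.1 j := by
  simp [symForm, Pi.single_apply]

theorem symForm_single_left {d : ℕ} (u : Ph d) (j : Fin d) :
    symForm u (Pi.single j 1, 0) = -u.2 j := by
  simp [symForm, Pi.single_apply]

theorem eq_of_symForm_eq {d : ℕ} {u w : Ph d} (h : ∀ v, symForm u v = symForm w v) : u = w := by
  ext j
  · simpa [symForm_single_right] using h (0, Pi.single j 1)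
  · simpa [symForm_single_left] using h (Pi.single j 1, 0)

theorem symForm_symGrad {d : ℕ} (l : Ph d →L[ℝ] ℝ) (v : Ph d) : symForm (symGrad l) v = l v := by
  have hv : v = ∑ i, (v.2 i • ((0, Pi.single i 1) : Ph d)
      + v.1 i • ((Pi.single i 1, 0) : Ph d)) := by
    ext j
    · simp [Prod.fst_sum, Finset.sum_apply, Pi.single_apply]
    · simp [Prod.snd_sum, Finset.sum_apply, Pi.single_apply]
  conv_rhs => rw [hv, map_sum]
  refine Finset.sum_congr rfl fun i _ => ?_
  simp only [map_add, map_smul, smul_eq_mul, symGrad, ContinuousLinearMap.prod_apply,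
    ContinuousLinearMap.coe_pi', neg_apply, ContinuousLinearMap.apply_apply]
  ring

theorem symForm_hamVF {d : ℕ} (H : Ph d → ℝ) (p v : Ph d) :
    symForm (hamVF H p) v = fderiv ℝ H p v := by
  rw [hamVF_eq_symGrad, symForm_symGrad]

theorem symForm_antisymm {d : ℕ} (u v : Ph d) : symForm u v = -symForm v u := by
  simp only [symForm, ← Finset.sum_neg_distrib]
  exact Finset.sum_congr rfl fun i _ => by ring

theorem symForm_add_smul {d : ℕ} (c : ℝ) (u u' v v' : Ph d) :
    symForm (u + c • u') (v + c • v') =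
      symForm u v + c * (symForm u v' + symForm u' v) + c ^ 2 * symForm u' v' := by
  simp only [symForm, Finset.mul_sum, ← Finset.sum_add_distrib]
  refine Finset.sum_congr rfl fun i _ => ?_
  simp only [Prod.fst_add, Prod.snd_add, Prod.smul_fst, Prod.smul_snd, Pi.add_apply,
    Pi.smul_apply, smul_eq_mul]
  ring

/-- A smooth symplectic diffeomorphism of phase space. -/
structure IsSymplecto {d : ℕ} (f : Equiv.Perm (Ph d)) : Prop where
  smooth : ContDiff ℝ (⊤ : ℕ∞) f
  smooth_symm : ContDiff ℝ (⊤ : ℕ∞) f.symm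
  symp : ∀ p u v, symForm (fderiv ℝ f p u) (fderiv ℝ f p v) = symForm u v

namespace IsSymplecto

variable {d : ℕ} {f g : Equiv.Perm (Ph d)}

theorem differentiable (hf : IsSymplecto f) : Differentiable ℝ f :=
  hf.smooth.differentiable (by simp)

theorem differentiable_symm (hf : IsSymplecto f) : Differentiable ℝ f.symm :=
  hf.smooth_symm.differentiable (by simp)

theorem one : IsSymplecto (1 : Equiv.Perm (Ph d)) where
  smooth := contDiff_id
  smooth_symm := contDiff_id
  symp p u v := by
    have : ((1 : Equiv.Perm (Ph d)) : Ph d → Ph d) = id := rfl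
    simp [this]

theorem mul (hf : IsSymplecto f) (hg : IsSymplecto g) : IsSymplecto (f * g) where
  smooth := hf.smooth.comp hg.smooth
  smooth_symm := hg.smooth_symm.comp hf.smooth_symm
  symp p u v := by
    rw [Equiv.Perm.coe_mul, fderiv_comp _ (hf.differentiable _) (hg.differentiable _)]
    simp only [ContinuousLinearMap.comp_apply, hf.symp, hg.symp]

theorem pow (hf : IsSymplecto f) (n : ℕ) : IsSymplecto (f ^ n) := by
  induction n with
  | zero => exact one
  | succ n ih => rw [pow_succ]; exact ih.mul hf

theorem fderiv_fderiv_symm (hf : IsSymplecto f) (p v : Ph d) :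
    fderiv ℝ f p (fderiv ℝ f.symm (f p) v) = v := by
  have h := fderiv_comp (f p) (g := f) (f := f.symm)
    (hf.differentiable _) (hf.differentiable_symm _)
  rw [show (f : Ph d → Ph d) ∘ f.symm = id by ext1 x; simp, fderiv_id, f.symm_apply_apply] at h
  exact (congrArg (fun l => l v) h).symm

/-- Symplectic diffeomorphisms transport Hamiltonian vector fields. -/
theorem hamVF_comp_symm (hf : IsSymplecto f) {L : Ph d → ℝ} (hL : Differentiable ℝ L)
    (p : Ph d) : hamVF (L ∘ f.symm) (f p) = fderiv ℝ f p (hamVF L p) := by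
  refine eq_of_symForm_eq fun v => ?_
  conv_rhs => rw [← hf.fderiv_fderiv_symm p v]
  rw [hf.symp, symForm_hamVF, symForm_hamVF,
    fderiv_comp _ (hL _) (hf.differentiable_symm _), f.symm_apply_apply]
  rfl

end IsSymplecto

/-- The derivative of the action `r_j` at `p`. -/
def dAct {d : ℕ} (j : Fin d) (p : Ph d) : Ph d →L[ℝ] ℝ :=
  p.1 j • (ContinuousLinearMap.proj j).comp (ContinuousLinearMap.fst ℝ _ _)
    + p.2 j • (ContinuousLinearMap.proj j).comp (ContinuousLinearMap.snd ℝ _ _)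

theorem dAct_apply {d : ℕ} (j : Fin d) (p v : Ph d) :
    dAct j p v = p.1 j * v.1 j + p.2 j * v.2 j := rfl

theorem hasFDerivAt_fst_apply {d : ℕ} (j : Fin d) (p : Ph d) :
    HasFDerivAt (fun q : Ph d => q.1 j)
      ((ContinuousLinearMap.proj j).comp (ContinuousLinearMap.fst ℝ _ _)) p :=
  ContinuousLinearMap.hasFDerivAt (𝕜 := ℝ) (E := Ph d) (F := ℝ)
    ((ContinuousLinearMap.proj j).comp (ContinuousLinearMap.fst ℝ _ _))

theorem hasFDerivAt_snd_apply {d : ℕ} (j : Fin d) (p : Ph d) :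
    HasFDerivAt (fun q : Ph d => q.2 j)
      ((ContinuousLinearMap.proj j).comp (ContinuousLinearMap.snd ℝ _ _)) p :=
  ContinuousLinearMap.hasFDerivAt (𝕜 := ℝ) (E := Ph d) (F := ℝ)
    ((ContinuousLinearMap.proj j).comp (ContinuousLinearMap.snd ℝ _ _))

theorem hasFDerivAt_actJ {d : ℕ} (j : Fin d) (p : Ph d) :
    HasFDerivAt (actJ j) (dAct j p) p := by
  have h := (((hasFDerivAt_fst_apply j p).pow 2).add
    ((hasFDerivAt_snd_apply j p).pow 2)).mul_const (2⁻¹ : ℝ)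
  refine (h.congr_fderiv ?_).congr_of_eventuallyEq (Eventually.of_forall fun q => ?_)
  · ext v <;> simp [dAct] <;> ring
  · simp [actJ, div_eq_mul_inv]

theorem contDiff_fst_apply {d : ℕ} {n : WithTop ℕ∞} (j : Fin d) :
    ContDiff ℝ n (fun p : Ph d => p.1 j) :=
  (contDiff_apply ℝ ℝ j).comp contDiff_fst

theorem contDiff_snd_apply {d : ℕ} {n : WithTop ℕ∞} (j : Fin d) :
    ContDiff ℝ n (fun p : Ph d => p.2 j) :=
  (contDiff_apply ℝ ℝ j).comp contDiff_snd

theorem contDiff_actJ {d : ℕ} {n : WithTop ℕ∞} (j : Fin d) :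
    ContDiff ℝ n (actJ j : Ph d → ℝ) :=
  (((contDiff_fst_apply j).pow 2).add ((contDiff_snd_apply j).pow 2)).div_const 2

theorem continuous_actJ {d : ℕ} (j : Fin d) : Continuous (actJ j : Ph d → ℝ) :=
  (contDiff_actJ (n := 0) j).continuous

theorem actJ_nonneg {d : ℕ} (j : Fin d) (p : Ph d) : 0 ≤ actJ j p := by
  unfold actJ; positivity

/-- The diagonal rotation with angles `τ`. -/
def rot {d : ℕ} (τ : Fin d → ℝ) (p : Ph d) : Ph d :=
  (fun i => Real.cos (τ i) * p.1 i + Real.sin (τ i) * p.2 i,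
   fun i => -Real.sin (τ i) * p.1 i + Real.cos (τ i) * p.2 i)

/-- The infinitesimal diagonal rotation with frequencies `ν`. -/
def rotGen {d : ℕ} (ν : Fin d → ℝ) (p : Ph d) : Ph d :=
  (fun i => ν i * p.2 i, fun i => -(ν i * p.1 i))

theorem rot_zero {d : ℕ} (p : Ph d) : rot 0 p = p := by
  ext <;> simp [rot]

theorem rot_add {d : ℕ} (σ τ : Fin d → ℝ) (p : Ph d) : rot (σ + τ) p = rot σ (rot τ p) := by
  ext i <;> simp only [rot, Pi.add_apply, Real.cos_add, Real.sin_add] <;> ring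

theorem actJ_rot {d : ℕ} (j : Fin d) (τ : Fin d → ℝ) (p : Ph d) :
    actJ j (rot τ p) = actJ j p := by
  simp only [actJ, rot]
  linear_combination (p.1 j ^ 2 + p.2 j ^ 2) / 2 * Real.sin_sq_add_cos_sq (τ j)

theorem hasDerivAt_rot {d : ℕ} (ν : Fin d → ℝ) (p : Ph d) (t : ℝ) :
    HasDerivAt (fun t : ℝ => rot (t • ν) p) (rotGen ν (rot (t • ν) p)) t := by
  refine HasDerivAt.prodMk (hasDerivAt_pi.2 fun i => ?_) (hasDerivAt_pi.2 fun i => ?_)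
  · have h : HasDerivAt (fun t : ℝ => (t • ν) i) (ν i) t := by
      simpa using (hasDerivAt_id t).mul_const (ν i)
    refine ((h.cos.mul_const (p.1 i)).add (h.sin.mul_const (p.2 i))).congr_deriv ?_
    simp only [rot]; ring
  · have h : HasDerivAt (fun t : ℝ => (t • ν) i) (ν i) t := by
      simpa using (hasDerivAt_id t).mul_const (ν i)
    refine ((h.sin.neg.mul_const (p.1 i)).add (h.cos.mul_const (p.2 i))).congr_deriv ?_
    simp only [rot]; ring

theorem hamVF_of_hasFDerivAt {d : ℕ} {H : Ph d → ℝ} {ν : Fin d → ℝ} {p : Ph d}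
    (h : HasFDerivAt H (∑ j, ν j • dAct j p) p) : hamVF H p = rotGen ν p := by
  ext i <;> simp [hamVF, rotGen, h.fderiv, dAct, Pi.single_apply]

/-- A smooth function which is homogeneous of degree three vanishes to second order. -/
theorem iteratedFDeriv_eq_zero_of_cubic {E : Type*} [NormedAddCommGroup E] [NormedSpace ℝ E]
    {f : E → ℝ} (hf : ContDiff ℝ (⊤ : ℕ∞) f) (h : ∀ p, f ((2 : ℝ) • p) = (8 : ℝ) • f p)
    {k : ℕ} (hk : k ≤ 2) : iteratedFDeriv ℝ k f 0 = 0 := by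
  have hfk : ContDiff ℝ k f := hf.of_le (by exact_mod_cast le_top)
  have h1 := congrFun (iteratedFDeriv_comp_const_smul (2 : ℝ) hfk) 0
  rw [funext h, smul_zero, iteratedFDeriv_const_smul_apply' hfk.contDiffAt] at h1
  rw [← sub_eq_zero, ← sub_smul, smul_eq_zero] at h1
  refine h1.resolve_left ?_
  interval_cases k <;> norm_num

/-- The integrable case: a zero frequency gives an explicit drifting Hamiltonian. -/
theorem exists_of_freq_eq_zero {d : ℕ} (ω₀ : Fin d → ℝ) {o m : Fin d} (hom : m ≠ o)
    (h0 : ω₀ o = 0) :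
    ∃ H : Ph d → ℝ, ContDiff ℝ (⊤ : ℕ∞) H ∧ IsEllipticNF ω₀ H ∧
      ∃ Φ : ℝ → Ph d → Ph d, IsGlobalFlow H Φ ∧
        ¬ ∃ K : Set (Ph d), K.Nonempty ∧ IsCompact K ∧
            K ∩ {q : Ph d | ∃ i, actJ i q = 0} = ∅ ∧
            ∀ t : ℝ, Φ t '' K ⊆ K := by
  set ν : Ph d → Fin d → ℝ := fun p => ω₀ + Pi.single m (2 * p.1 o) with hν
  set Φ : ℝ → Ph d → Ph d := fun t p =>
    rot (t • ν p) p + t • ((0, Pi.single o (-2 * actJ m p)) : Ph d) with hΦ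
  have hνo (p : Ph d) : ν p o = 0 := by simp [hν, h0, hom.symm]
  have hfst (t : ℝ) (p : Ph d) : (Φ t p).1 o = p.1 o := by simp [hΦ, rot, hνo]
  have hsnd (t : ℝ) (p : Ph d) : (Φ t p).2 o = p.2 o - 2 * t * actJ m p := by
    simp [hΦ, rot, hνo]; ring
  have hνΦ (t : ℝ) (p : Ph d) : ν (Φ t p) = ν p := by simp only [hν, hfst]
  have hact (t : ℝ) (p : Ph d) : actJ m (Φ t p) = actJ m p := by
    rw [← actJ_rot m (t • ν p) p]
    simp [hΦ, actJ, hom]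
  refine ⟨fun p => ∑ j, ω₀ j * actJ j p + 2 * p.1 o * actJ m p, ?_, ?_, Φ, ⟨?_, ?_, ?_⟩, ?_⟩
  · exact (ContDiff.sum fun j _ => contDiff_const.mul (contDiff_actJ j)).add
      ((contDiff_const.mul (contDiff_fst_apply o)).mul (contDiff_actJ m))
  · intro k hk
    refine iteratedFDeriv_eq_zero_of_cubic ?_ ?_ hk
    · simpa only [add_sub_cancel_left] using
        ((contDiff_const.mul (contDiff_fst_apply o)).mul (contDiff_actJ m))
    · intro p
      simp only [actJ, Prod.smul_fst, Prod.smul_snd, Pi.smul_apply, smul_eq_mul]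
      ring
  · intro p; simp [hΦ, rot_zero]
  · intro s t p
    have h1 : Φ (s + t) p = rot (s • ν p) (rot (t • ν p) p)
        + (s + t) • ((0, Pi.single o (-2 * actJ m p)) : Ph d) := by
      simp only [hΦ, add_smul, rot_add]
    have h2 : Φ s (Φ t p) = rot (s • ν p) (Φ t p)
        + s • ((0, Pi.single o (-2 * actJ m p)) : Ph d) := by
      rw [← hνΦ t p, ← hact t p]
    rw [h1, h2]
    ext i <;> by_cases hi : i = o
    all_goals simp [hΦ, rot, hi, hνo]
    ring
  · intro p t
    have hd := (hasDerivAt_rot (ν p) p t).add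
      ((hasDerivAt_id t).smul_const ((0, Pi.single o (-2 * actJ m p)) : Ph d))
    refine hd.congr_deriv ?_
    have hH (q : Ph d) : hamVF (fun p => ∑ j, ω₀ j * actJ j p + 2 * p.1 o * actJ m p) q
        = rotGen (ν q) q + (0, Pi.single o (-2 * actJ m q)) := by
      have := (HasFDerivAt.fun_sum (u := Finset.univ) fun j _ =>
        (hasFDerivAt_actJ j q).const_mul (ω₀ j)).fun_add
        (((hasFDerivAt_fst_apply o q).const_mul 2).fun_mul (hasFDerivAt_actJ m q))
      rw [hamVF, this.fderiv]
      ext i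
      · rcases eq_or_ne i m with rfl | hi
        · simp [rotGen, hν, dAct, Pi.single_apply]; ring
        · simp [rotGen, hν, dAct, Pi.single_apply, hi, hi.symm]
      · rcases eq_or_ne i m with rfl | hi
        · simp [rotGen, hν, dAct, Pi.single_apply, hom, hom.symm]; ring
        · simp [rotGen, hν, dAct, Pi.single_apply, hi, hi.symm, eq_comm (a := o)]
          split_ifs <;> ring
    rw [hH, hνΦ, hact, one_smul]
    congr 1
    ext i <;> by_cases hi : i = o
    all_goals simp [rotGen, hΦ, hi, hνo]
  · rintro ⟨K, ⟨p, hp⟩, hK, hKd, hinv⟩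
    have hpm : 0 < actJ m p := (actJ_nonneg m p).lt_of_ne' fun h =>
      (Set.eq_empty_iff_forall_notMem.1 hKd p) ⟨hp, m, h⟩
    obtain ⟨C, hC⟩ := hK.exists_bound_of_continuousOn
      (f := fun q : Ph d => q.2 o) ((contDiff_snd_apply (n := 0) o).continuous.continuousOn)
    have h := hC _ (hinv ((p.2 o - (C + 1)) / (2 * actJ m p)) ⟨p, hp, rfl⟩)
    rw [hsnd, Real.norm_eq_abs] at h
    have : p.2 o - 2 * ((p.2 o - (C + 1)) / (2 * actJ m p)) * actJ m p = C + 1 := by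
      field_simp; ring
    rw [this] at h
    linarith [le_abs_self (C + 1)]

/-- A smooth contraction perturbs the identity to a smooth diffeomorphism. -/
theorem exists_perm_add {E : Type*} [NormedAddCommGroup E] [NormedSpace ℝ E] [CompleteSpace E]
    {Y : E → E} (hY : ContDiff ℝ (⊤ : ℕ∞) Y) {K : NNReal} (hK : LipschitzWith K Y) (hK1 : K < 1) :
    ∃ f : Equiv.Perm E, (∀ p, f p = p + Y p) ∧ ContDiff ℝ (⊤ : ℕ∞) f.symm := by
  have happ : ApproximatesLinearOn (fun p => p + Y p)
      ((ContinuousLinearEquiv.refl ℝ E : E ≃L[ℝ] E) : E →L[ℝ] E) univ K := by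
    intro x _ y _
    have := hK.dist_le_mul x y
    simp only [dist_eq_norm] at this
    simpa [add_sub_add_comm] using this
  have hc : Subsingleton E ∨
      K < ‖((ContinuousLinearEquiv.refl ℝ E).symm : E →L[ℝ] E)‖₊⁻¹ := by
    rcases subsingleton_or_nontrivial E with h | h
    · exact Or.inl h
    · right
      have : ‖((ContinuousLinearEquiv.refl ℝ E).symm : E →L[ℝ] E)‖₊ = 1 :=
        ContinuousLinearMap.nnnorm_id
      rwa [this, inv_one]
  have hsm : ContDiff ℝ (⊤ : ℕ∞) (happ.toHomeomorph _ hc) := contDiff_id.add hY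
  have hlt (a : E) : ‖-fderiv ℝ Y a‖ < 1 := by
    rw [norm_neg]
    exact (norm_fderiv_le_of_lipschitz ℝ hK).trans_lt (by exact_mod_cast hK1)
  refine ⟨(happ.toHomeomorph _ hc).toEquiv, fun p => rfl, ?_⟩
  refine Homeomorph.contDiff_symm (happ.toHomeomorph _ hc)
    (f₀' := fun a => ContinuousLinearEquiv.ofUnit (Units.oneSub _ (hlt a))) (fun a => ?_) hsm
  refine ((hasFDerivAt_id a).add
    ((hY.differentiable (by simp)) a).hasFDerivAt).congr_fderiv ?_
  ext v
  change v + fderiv ℝ Y a v = (1 - -fderiv ℝ Y a) v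
  simp

theorem contDiff_hamVF {d : ℕ} {G : Ph d → ℝ} (hG : ContDiff ℝ (⊤ : ℕ∞) G) :
    ContDiff ℝ (⊤ : ℕ∞) (hamVF G) := by
  have : hamVF G = symGrad ∘ fderiv ℝ G := funext (hamVF_eq_symGrad G)
  rw [this]
  exact symGrad.contDiff.comp (hG.fderiv_right (by simp))

theorem hasCompactSupport_hamVF {d : ℕ} {G : Ph d → ℝ} (hG : HasCompactSupport G) :
    HasCompactSupport (hamVF G) := by
  have : hamVF G = symGrad ∘ fderiv ℝ G := funext (hamVF_eq_symGrad G)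
  rw [this]
  exact (hG.fderiv ℝ).comp_left (map_zero _)

/-- The linearization of a Hamiltonian vector field is infinitesimally symplectic. -/
theorem symForm_fderiv_hamVF {d : ℕ} {G : Ph d → ℝ} (hG : ContDiff ℝ (⊤ : ℕ∞) G) (p u v : Ph d) :
    symForm u (fderiv ℝ (hamVF G) p v) + symForm (fderiv ℝ (hamVF G) p u) v = 0 := by
  have hfd : DifferentiableAt ℝ (fderiv ℝ G) p :=
    (hG.fderiv_right (m := (⊤ : ℕ∞)) (by simp)).differentiable (by simp) p
  have hX (w : Ph d) : fderiv ℝ (hamVF G) p w = symGrad (fderiv ℝ (fderiv ℝ G) p w) := by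
    have : hamVF G = symGrad ∘ fderiv ℝ G := funext (hamVF_eq_symGrad G)
    rw [this, fderiv_comp _ symGrad.differentiableAt hfd]
    simp
  have hsymm : IsSymmSndFDerivAt ℝ G p :=
    hG.contDiffAt.isSymmSndFDerivAt (by simpa using WithTop.coe_le_coe.2 (le_top : (2 : ℕ∞) ≤ ⊤))
  rw [symForm_antisymm u, hX, hX, symForm_symGrad, symForm_symGrad, hsymm.eq u v]
  ring

/-- The symplectic map `p - c X p ↦ p + c X p`, for the Hamiltonian vector field `X = hamVF G`. -/
theorem exists_midpoint {d : ℕ} {G : Ph d → ℝ} (hG : ContDiff ℝ (⊤ : ℕ∞) G) {K : NNReal}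
    (hK : LipschitzWith K (hamVF G)) {c : NNReal} (hc : c * K < 1) :
    ∃ A g : Equiv.Perm (Ph d), Continuous A.symm ∧ IsSymplecto g ∧
      (∀ p, A p = p - (c : ℝ) • hamVF G p) ∧ ∀ p, g (A p) = p + (c : ℝ) • hamVF G p := by
  have hX := contDiff_hamVF hG
  have hlip (e : ℝ) (he : ‖e‖₊ = c) : LipschitzWith (c * K) (fun p => e • hamVF G p) := by
    rw [← he]; exact (lipschitzWith_smul e).comp hK
  obtain ⟨A, hA, hAs⟩ := exists_perm_add (Y := fun p => (-(c : ℝ)) • hamVF G p)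
    (hX.const_smul _) (hlip _ (by simp)) hc
  obtain ⟨B, hB, hBs⟩ := exists_perm_add (Y := fun p => (c : ℝ) • hamVF G p)
    (hX.const_smul _) (hlip _ (by simp)) hc
  have hsm (f : Equiv.Perm (Ph d)) (e : ℝ) (hf : ∀ p, f p = p + e • hamVF G p) :
      ContDiff ℝ (⊤ : ℕ∞) f := by
    rw [funext hf]; exact contDiff_id.add (hX.const_smul _)
  have hder (f : Equiv.Perm (Ph d)) (e : ℝ) (hf : ∀ p, f p = p + e • hamVF G p) (p v : Ph d) :
      fderiv ℝ f p v = v + e • fderiv ℝ (hamVF G) p v := by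
    have hd := (hasFDerivAt_id p).fun_add
      ((hX.differentiable (by simp) p).hasFDerivAt.fun_const_smul e)
    rw [show (f : Ph d → Ph d) = fun p => id p + e • hamVF G p from funext hf, hd.fderiv]
    rfl
  have hAsm := hsm A _ hA
  have hBsm := hsm B _ hB
  have hAA (p v : Ph d) : fderiv ℝ A (A.symm p) (fderiv ℝ A.symm p v) = v := by
    have h := fderiv_comp p (g := A) (f := A.symm)
      (hAsm.differentiable (by simp) _) (hAs.differentiable (by simp) _)
    rw [show (A : Ph d → Ph d) ∘ A.symm = id by ext1 x; simp, fderiv_id] at h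
    exact (congrArg (fun l => l v) h).symm
  refine ⟨A, B * A⁻¹, hAs.continuous, ⟨hBsm.comp hAs, hAsm.comp hBs, fun p u v => ?_⟩,
    fun p => by rw [hA, neg_smul, sub_eq_add_neg], fun p => by simp [hB]⟩
  have hcomp : ((B * A⁻¹ : Equiv.Perm (Ph d)) : Ph d → Ph d) = B ∘ A.symm := rfl
  rw [hcomp, fderiv_comp _ (hBsm.differentiable (by simp) _) (hAs.differentiable (by simp) _)]
  conv_rhs => rw [← hAA p u, ← hAA p v]
  simp only [ContinuousLinearMap.comp_apply, hder A _ hA, hder B _ hB, symForm_add_smul,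
    symForm_fderiv_hamVF hG]
  ring

/-- Diagonal rotations as permutations of phase space. -/
def rotPerm {d : ℕ} (τ : Fin d → ℝ) : Equiv.Perm (Ph d) where
  toFun := rot τ
  invFun := rot (-τ)
  left_inv p := by rw [← rot_add, neg_add_cancel, rot_zero]
  right_inv p := by rw [← rot_add, add_neg_cancel, rot_zero]

/-- Diagonal rotations as continuous linear maps. -/
def rotCLM {d : ℕ} (τ : Fin d → ℝ) : Ph d →L[ℝ] Ph d :=
  LinearMap.toContinuousLinearMap
    { toFun := rot τ
      map_add' := fun p q => by ext <;> simp [rot] <;> ring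
      map_smul' := fun c p => by ext <;> simp [rot] <;> ring }

theorem rotCLM_apply {d : ℕ} (τ : Fin d → ℝ) (p : Ph d) : rotCLM τ p = rot τ p := rfl

theorem fderiv_rot {d : ℕ} (τ : Fin d → ℝ) (p : Ph d) : fderiv ℝ (rot τ) p = rotCLM τ :=
  (rotCLM τ).hasFDerivAt.fderiv

theorem isSymplecto_rotPerm {d : ℕ} (τ : Fin d → ℝ) : IsSymplecto (rotPerm τ) where
  smooth := (rotCLM τ).contDiff
  smooth_symm := (rotCLM (-τ)).contDiff
  symp p u v := by
    change symForm (fderiv ℝ (rot τ) p u) (fderiv ℝ (rot τ) p v) = _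
    simp only [fderiv_rot, rotCLM_apply, symForm, rot]
    refine Finset.sum_congr rfl fun i _ => ?_
    linear_combination (u.1 i * v.2 i - u.2 i * v.1 i) * Real.sin_sq_add_cos_sq (τ i)

theorem hamVF_rot {d : ℕ} {G : Ph d → ℝ} (hG : Differentiable ℝ G) {τ : Fin d → ℝ}
    (h : ∀ p, G (rot τ p) = G p) (p : Ph d) : hamVF G (rot τ p) = rot τ (hamVF G p) := by
  have h1 := (isSymplecto_rotPerm τ).hamVF_comp_symm hG p
  have h2 : G ∘ (rotPerm τ).symm = G := by
    ext q
    rw [Function.comp_apply, ← h]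
    exact congrArg G ((rotPerm τ).apply_symm_apply q)
  rw [h2] at h1
  exact h1.trans (by
    change fderiv ℝ (rot τ) p _ = _
    rw [fderiv_rot, rotCLM_apply])

/-- Infinitesimal form of the invariance of `G` under a one-parameter group of rotations. -/
theorem sum_mul_hamVF_eq_zero {d : ℕ} {G : Ph d → ℝ} (hG : Differentiable ℝ G) {ν : Fin d → ℝ}
    (h : ∀ (t : ℝ) p, G (rot (t • ν) p) = G p) (p : Ph d) :
    ∑ j, ν j * dAct j p (hamVF G p) = 0 := by
  have h1 := (hG (rot ((0 : ℝ) • ν) p)).hasFDerivAt.comp_hasDerivAt 0 (hasDerivAt_rot ν p 0)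
  rw [show G ∘ (fun t : ℝ => rot (t • ν) p) = fun _ => G p from funext fun t => h t p,
    zero_smul, rot_zero] at h1
  have h2 := h1.unique (hasDerivAt_const _ _)
  rw [← symForm_hamVF] at h2
  rw [← neg_eq_zero, ← h2, symForm, ← Finset.sum_neg_distrib]
  refine Finset.sum_congr rfl fun j _ => ?_
  simp only [dAct_apply, rotGen]
  ring

theorem actJ_add_smul {d : ℕ} (j : Fin d) (p v : Ph d) (c : ℝ) :
    actJ j (p + c • v) = actJ j p + c * dAct j p v + c ^ 2 * actJ j v := by
  simp only [actJ, dAct_apply, Prod.fst_add, Prod.snd_add, Prod.smul_fst, Prod.smul_snd,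
    Pi.add_apply, Pi.smul_apply, smul_eq_mul]
  ring

/-- Independent rescaling of the coordinate planes. -/
def scale {d : ℕ} (μ : Fin d → ℝ) (p : Ph d) : Ph d := (μ * p.1, μ * p.2)

theorem actJ_scale {d : ℕ} (j : Fin d) (μ : Fin d → ℝ) (p : Ph d) :
    actJ j (scale μ p) = μ j ^ 2 * actJ j p := by
  simp only [actJ, scale, Pi.mul_apply]; ring

/-- The complex coordinate `x_j + i e y_j`. -/
def cplx {d : ℕ} (e : ℝ) (j : Fin d) (p : Ph d) : ℂ := (p.1 j : ℂ) + (e * p.2 j : ℝ) * Complex.I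

/-- The resonant monomial `(x_o + i y_o)^a (x_m + i ε y_m)^b`. -/
def resMon {d : ℕ} (o m : Fin d) (a b : ℕ) (ε : ℝ) (p : Ph d) : ℂ :=
  cplx 1 o p ^ a * cplx ε m p ^ b

/-- The exponent vector of the resonant monomial. -/
def resVec {d : ℕ} (o m : Fin d) (a b : ℕ) (ε : ℝ) : Fin d → ℝ :=
  Pi.single o (a : ℝ) + Pi.single m (ε * b)

section resMon

variable {d : ℕ} {o m : Fin d} {a b : ℕ} {ε : ℝ}

theorem resVec_left (hom : m ≠ o) : resVec o m a b ε o = a := by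
  simp [resVec, hom.symm]

theorem sum_resVec_mul (f : Fin d → ℝ) :
    ∑ j, resVec o m a b ε j * f j = a * f o + ε * b * f m := by
  simp [resVec, add_mul, Finset.sum_add_distrib, Pi.single_apply]

theorem contDiff_cplx {n : WithTop ℕ∞} {e : ℝ} {j : Fin d} : ContDiff ℝ n (cplx e j) :=
  (Complex.ofRealCLM.contDiff.comp (contDiff_fst_apply j)).add
    ((Complex.ofRealCLM.contDiff.comp (contDiff_const.mul (contDiff_snd_apply j))).mul
      contDiff_const)

theorem contDiff_resMon {n : WithTop ℕ∞} : ContDiff ℝ n (resMon (d := d) o m a b ε) :=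
  (contDiff_cplx.pow a).mul (contDiff_cplx.pow b)

theorem cplx_scale (e : ℝ) (j : Fin d) (μ : Fin d → ℝ) (p : Ph d) :
    cplx e j (scale μ p) = μ j * cplx e j p := by
  simp only [cplx, scale, Pi.mul_apply]
  push_cast; ring

theorem resMon_scale (μ : Fin d → ℝ) (p : Ph d) :
    resMon o m a b ε (scale μ p) = (μ o ^ a * μ m ^ b : ℝ) * resMon o m a b ε p := by
  simp only [resMon, cplx_scale, mul_pow]
  push_cast; ring

theorem cplx_rot {e : ℝ} (he : e = 1 ∨ e = -1) (j : Fin d) (τ : Fin d → ℝ) (p : Ph d) :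
    cplx e j (rot τ p) = Complex.exp (-(e * τ j : ℝ) * Complex.I) * cplx e j p := by
  rw [← Complex.ofReal_neg, Complex.exp_mul_I, ← Complex.ofReal_cos, ← Complex.ofReal_sin]
  apply Complex.ext <;> rcases he with rfl | rfl <;> simp [cplx, rot]
  all_goals ring

theorem resMon_rot (hε : ε = 1 ∨ ε = -1) (τ : Fin d → ℝ) (p : Ph d) :
    resMon o m a b ε (rot τ p)
      = Complex.exp (-(a * τ o + ε * b * τ m : ℝ) * Complex.I) * resMon o m a b ε p := by
  rw [resMon, cplx_rot (Or.inl rfl), cplx_rot hε, mul_pow, mul_pow, ← Complex.exp_nat_mul,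
    ← Complex.exp_nat_mul, show (-(a * τ o + ε * b * τ m : ℝ) * Complex.I : ℂ)
      = a * (-(1 * τ o : ℝ) * Complex.I) + b * (-(ε * τ m : ℝ) * Complex.I) by push_cast; ring,
    Complex.exp_add, resMon]
  ring

theorem normSq_cplx {e : ℝ} (he : e = 1 ∨ e = -1) (j : Fin d) (p : Ph d) :
    Complex.normSq (cplx e j p) = 2 * actJ j p := by
  rw [cplx, Complex.normSq_add_mul_I, actJ, mul_pow]
  rcases he with rfl | rfl <;> ring

theorem cplx_ne_zero {e : ℝ} (he : e = 1 ∨ e = -1) {j : Fin d} {p : Ph d} (hj : actJ j p ≠ 0) :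
    cplx e j p ≠ 0 := by
  rw [← Complex.normSq_pos, normSq_cplx he]
  exact mul_pos two_pos ((actJ_nonneg j p).lt_of_ne' hj)

theorem resMon_ne_zero (hε : ε = 1 ∨ ε = -1) {p : Ph d} (ho : actJ o p ≠ 0) (hm : actJ m p ≠ 0) :
    resMon o m a b ε p ≠ 0 :=
  mul_ne_zero (pow_ne_zero _ (cplx_ne_zero (Or.inl rfl) ho)) (pow_ne_zero _ (cplx_ne_zero hε hm))

theorem re_angular {e : ℝ} (he : e = 1 ∨ e = -1) {j : Fin d} {p : Ph d} (hj : actJ j p ≠ 0)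
    (s : ℝ) (v : Ph d) : (s * Complex.I * cplx e j v / cplx e j p).re
      = e * (s / (2 * actJ j p) * (v.1 j * p.2 j - v.2 j * p.1 j)) := by
  rw [Complex.div_re, normSq_cplx he]
  simp only [cplx, Complex.mul_re, Complex.mul_im, Complex.add_re, Complex.add_im,
    Complex.ofReal_re, Complex.ofReal_im, Complex.I_re, Complex.I_im]
  field_simp
  ring

/-- On the line `Re Z = 0` the differential of `Re Z` is a combination of angular forms. -/
theorem fderiv_re_resMon (hε : ε = 1 ∨ ε = -1) {p : Ph d} (ho : actJ o p ≠ 0)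
    (hm : actJ m p ≠ 0) (hre : (resMon o m a b ε p).re = 0) (v : Ph d) :
    fderiv ℝ (fun q => (resMon o m a b ε q).re) p v = ∑ j, resVec o m a b ε j *
      ((resMon o m a b ε p).im / (2 * actJ j p) * (v.1 j * p.2 j - v.2 j * p.1 j)) := by
  have hc (j : Fin d) (e : ℝ) : ∃ D : Ph d →L[ℝ] ℂ, HasFDerivAt (cplx e j) D p ∧
      ∀ v, D v = cplx e j v :=
    ⟨_, (Complex.ofRealCLM.hasFDerivAt.comp p (hasFDerivAt_fst_apply j p)).fun_add
      ((Complex.ofRealCLM.hasFDerivAt.comp p ((hasFDerivAt_snd_apply j p).const_mul e)).mul_const'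
        Complex.I), fun v => rfl⟩
  obtain ⟨D, hD, hDv⟩ := hc o 1
  obtain ⟨D', hD', hDv'⟩ := hc m ε
  have hd := Complex.reCLM.hasFDerivAt.comp p ((hD.pow a).mul (hD'.pow b))
  have hz := cplx_ne_zero (Or.inl rfl) ho
  have hw := cplx_ne_zero hε hm
  have hZ : resMon o m a b ε p = (resMon o m a b ε p).im * Complex.I := by
    conv_lhs => rw [← Complex.re_add_im (resMon o m a b ε p), hre]
    simp
  have hpow (n : ℕ) (u : ℂ) (hu : u ≠ 0) : n * u ^ (n - 1) = n * u ^ n / u := by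
    rcases n with _ | n
    · simp
    · rw [Nat.add_sub_cancel, pow_succ]; field_simp
  have key : fderiv ℝ (fun q => (resMon o m a b ε q).re) p v =
      (a * ((resMon o m a b ε p).im * Complex.I * cplx 1 o v / cplx 1 o p)
      + b * ((resMon o m a b ε p).im * Complex.I * cplx ε m v / cplx ε m p) : ℂ).re := by
    rw [← hZ]
    refine (congrArg (fun l => l v) hd.fderiv).trans ?_
    change (cplx 1 o p ^ a * ((b • cplx ε m p ^ (b - 1)) * D' v)
      + cplx ε m p ^ b * ((a • cplx 1 o p ^ (a - 1)) * D v)).re = _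
    rw [hDv, hDv', nsmul_eq_mul, nsmul_eq_mul, hpow _ _ hz, hpow _ _ hw, resMon]
    congr 1
    ring
  rw [key, sum_resVec_mul, Complex.add_re, ← Complex.ofReal_natCast, ← Complex.ofReal_natCast,
    Complex.re_ofReal_mul, Complex.re_ofReal_mul, re_angular (Or.inl rfl) ho, re_angular hε hm]
  ring

end resMon

theorem add_smul_scale {d : ℕ} (c : ℝ) (μ : Fin d → ℝ) (p : Ph d) :
    p + c • scale μ p = scale (1 + c • μ) p := by
  ext i <;> simp [scale] <;> ring

/-- The hypotheses on the cutoff functions used to localize the resonant kick. -/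
structure IsCutoff {d : ℕ} (cut : Ph d → ℝ) (v : ℝ) : Prop where
  smooth : ContDiff ℝ (⊤ : ℕ∞) cut
  hasCompactSupport : HasCompactSupport cut
  nonneg : ∀ p, 0 ≤ cut p
  rot : ∀ τ p, cut (rot τ p) = cut p
  pos : 0 < v
  lt_actJ : ∀ p, cut p ≠ 0 → ∀ j, v < actJ j p

/-- The localized resonant Hamiltonian. -/
def kickHam {d : ℕ} (cut : Ph d → ℝ) (o m : Fin d) (a b : ℕ) (ε : ℝ) (p : Ph d) : ℝ :=
  cut p * (resMon o m a b ε p).re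

/-- The radial rate of the field of `kickHam` on the line `Re Z = 0`. -/
def kickRate {d : ℕ} (cut : Ph d → ℝ) (o m : Fin d) (a b : ℕ) (ε : ℝ) (p : Ph d) (j : Fin d) : ℝ :=
  -(cut p * (resMon o m a b ε p).im * resVec o m a b ε j / (2 * actJ j p))

section kick

variable {d : ℕ} {o m : Fin d} {a b : ℕ} {ε v : ℝ} {cut : Ph d → ℝ}

theorem contDiff_kickHam (hcut : IsCutoff cut v) :
    ContDiff ℝ (⊤ : ℕ∞) (kickHam cut o m a b ε) :=
  hcut.smooth.mul (Complex.reCLM.contDiff.comp contDiff_resMon)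

theorem hamVF_kickHam_of_cut_eq_zero (hcut : IsCutoff cut v) {p : Ph d} (hp : cut p = 0) :
    hamVF (kickHam cut o m a b ε) p = 0 := by
  have hmin : IsLocalMin cut p := Eventually.of_forall fun q => by rw [hp]; exact hcut.nonneg q
  have h := (hcut.smooth.differentiable (by simp) p).hasFDerivAt.mul
    ((Complex.reCLM.contDiff.comp
      (contDiff_resMon (n := 1) (o := o) (m := m) (a := a) (b := b) (ε := ε))).differentiable
      (by simp) p).hasFDerivAt
  rw [hmin.fderiv_eq_zero, hp, zero_smul, smul_zero, add_zero] at h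
  rw [hamVF_eq_symGrad, show kickHam cut o m a b ε = _ from rfl]
  exact (congrArg symGrad h.fderiv).trans (map_zero _)

theorem hamVF_kickHam (hcut : IsCutoff cut v) (hε : ε = 1 ∨ ε = -1) {p : Ph d}
    (hre : (resMon o m a b ε p).re = 0) :
    hamVF (kickHam cut o m a b ε) p = scale (kickRate cut o m a b ε p) p := by
  by_cases hp : cut p = 0
  · rw [hamVF_kickHam_of_cut_eq_zero hcut hp]
    ext <;> simp [scale, kickRate, hp]
  have hact (j : Fin d) : actJ j p ≠ 0 := (hcut.pos.trans (hcut.lt_actJ p hp j)).ne'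
  have h := (hcut.smooth.differentiable (by simp) p).hasFDerivAt.mul
    ((Complex.reCLM.contDiff.comp
      (contDiff_resMon (n := 1) (o := o) (m := m) (a := a) (b := b) (ε := ε))).differentiable
      (by simp) p).hasFDerivAt
  refine eq_of_symForm_eq fun u => ?_
  rw [symForm_hamVF]
  refine (congrArg (fun l => l u) h.fderiv).trans ?_
  change cut p * fderiv ℝ (fun q => (resMon o m a b ε q).re) p u
    + (resMon o m a b ε p).re * fderiv ℝ cut p u = _
  rw [hre, zero_mul, add_zero, fderiv_re_resMon hε (hact o) (hact m) hre, Finset.mul_sum, symForm]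
  refine Finset.sum_congr rfl fun j _ => ?_
  simp only [scale, kickRate, Pi.mul_apply]
  ring

theorem exists_kickRate_bound (hcut : IsCutoff cut v) :
    ∃ M : ℝ, 0 < M ∧ ∀ p j, |kickRate cut o m a b ε p j| ≤ M := by
  have hs : Continuous fun p : Ph d => cut p * (resMon o m a b ε p).im :=
    hcut.smooth.continuous.mul
      (Complex.continuous_im.comp (contDiff_resMon (n := 0)).continuous)
  obtain ⟨C, hC⟩ := hs.bounded_above_of_compact_support hcut.hasCompactSupport.mul_right
  have hC0 : 0 ≤ C := (norm_nonneg _).trans (hC 0)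
  refine ⟨C * (∑ j, |resVec o m a b ε j|) / v + 1, by have := hcut.pos; positivity, fun p j => ?_⟩
  by_cases hp : cut p = 0
  · have := hcut.pos
    simp only [kickRate, hp, zero_mul, zero_div, neg_zero, abs_zero]
    positivity
  have hj := hcut.lt_actJ p hp j
  have hv := hcut.pos
  rw [kickRate, abs_neg, abs_div, abs_mul, abs_of_pos (by linarith : 0 < 2 * actJ j p)]
  have h1 : |resVec o m a b ε j| ≤ ∑ j, |resVec o m a b ε j| :=
    Finset.single_le_sum (f := fun j => |resVec o m a b ε j|) (fun i _ => abs_nonneg _)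
      (Finset.mem_univ j)
  refine (?_ : _ ≤ C * (∑ j, |resVec o m a b ε j|) / v).trans (by linarith)
  gcongr
  · exact hC p
  · linarith

/-- The resonant kick: a symplectic map commuting with the resonant rotations and moving the
points of the line `Re Z = 0` along rays, in a monotone way. -/
theorem exists_kick (hcut : IsCutoff cut v) (hε : ε = 1 ∨ ε = -1) :
    ∃ (g : Equiv.Perm (Ph d)) (w : Ph d → ℝ), IsSymplecto g ∧ Continuous w ∧
      (∀ z, cut z = 0 → g z = z) ∧
      (∀ τ : Fin d → ℝ, a * τ o + ε * b * τ m = 0 → ∀ z, g (rot τ z) = rot τ (g z)) ∧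
      (∀ ν : Fin d → ℝ, a * ν o + ε * b * ν m = 0 →
        ∀ z, ∑ j, ν j * actJ j (g z) = ∑ j, ν j * actJ j z) ∧
      ∀ z, (resMon o m a b ε z).re = 0 → (resMon o m a b ε (g z)).re = 0 ∧
        (∀ σ : ℝ, 0 ≤ σ * (resMon o m a b ε z).im →
          0 ≤ σ * (resMon o m a b ε (g z)).im ∧ 0 ≤ σ * w z) ∧
        (∀ j, actJ j (g z) = actJ j z - resVec o m a b ε j * w z) ∧
        (cut z ≠ 0 → 0 < (resMon o m a b ε z).im → 0 < w z) := by
  set Z := resMon (d := d) o m a b ε with hZdef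
  set G := kickHam cut o m a b ε with hGdef
  have hG : ContDiff ℝ (⊤ : ℕ∞) G := contDiff_kickHam hcut
  have hGd : Differentiable ℝ G := hG.differentiable (by simp)
  have hGsupp : HasCompactSupport G := hcut.hasCompactSupport.mul_right
  obtain ⟨K, hK⟩ := (contDiff_hamVF hG).lipschitzWith_of_hasCompactSupport
    (hasCompactSupport_hamVF hGsupp) (by simp)
  obtain ⟨M, hM0, hM⟩ := exists_kickRate_bound (o := o) (m := m) (a := a) (b := b) (ε := ε) hcut
  obtain ⟨c, hc0, hcK, hcM⟩ : ∃ c : NNReal, 0 < c ∧ c * K < 1 ∧ c * M ≤ 1 / 4 := by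
    obtain ⟨e, he, h1, h2⟩ : ∃ e : ℝ, 0 < e ∧ e * K < 1 ∧ e * M ≤ 1 / 4 := by
      refine ⟨1 / (2 * K + 4 * M), by positivity, ?_, ?_⟩
      · rw [div_mul_eq_mul_div, div_lt_one (by positivity)]
        nlinarith [K.coe_nonneg]
      · rw [div_mul_eq_mul_div, div_le_div_iff₀ (by positivity) (by positivity)]
        nlinarith [K.coe_nonneg]
    lift e to NNReal using he.le
    exact ⟨e, by exact_mod_cast he, by exact_mod_cast h1, h2⟩
  obtain ⟨A, g, hAc, hg, hA, hgA⟩ := exists_midpoint hG hK hcK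
  have hGrot (τ : Fin d → ℝ) (hτ : a * τ o + ε * b * τ m = 0) (p : Ph d) :
      G (rot τ p) = G p := by
    simp only [hGdef, kickHam, hcut.rot, resMon_rot hε, hτ]
    simp
  refine ⟨g, fun z => 2 * c * (cut (A.symm z) * (Z (A.symm z)).im), hg, ?_, ?_, ?_, ?_, ?_⟩
  · exact continuous_const.mul ((hcut.smooth.continuous.comp hAc).mul
      (Complex.continuous_im.comp ((contDiff_resMon (n := 0)).continuous.comp hAc)))
  · intro z hz
    have h0 := hamVF_kickHam_of_cut_eq_zero (o := o) (m := m) (a := a) (b := b) (ε := ε) hcut hz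
    have hAz : A z = z := by rw [hA, h0, smul_zero, sub_zero]
    conv_lhs => rw [← hAz, hgA, h0, smul_zero, add_zero]
  · intro τ hτ z
    obtain ⟨q, rfl⟩ := A.surjective z
    have h := hamVF_rot hGd (hGrot τ hτ) q
    have hAq : rot τ (A q) = A (rot τ q) := by
      rw [hA, hA, h]
      simp only [← rotCLM_apply, map_sub, map_smul]
    rw [hAq, hgA, hgA, h]
    simp only [← rotCLM_apply, map_add, map_smul]
  · intro ν hν z
    obtain ⟨q, rfl⟩ := A.surjective z
    have h := sum_mul_hamVF_eq_zero hGd (ν := ν) (fun t p => hGrot (t • ν) (by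
      simp only [Pi.smul_apply, smul_eq_mul]; linear_combination t * hν) p) q
    rw [hgA, hA, sub_eq_add_neg, ← neg_smul]
    simp only [actJ_add_smul, mul_add, Finset.sum_add_distrib, neg_sq]
    have h' (e : ℝ) : ∑ j, ν j * (e * dAct j q (hamVF G q)) = 0 := by
      rw [← mul_zero e, ← h, Finset.mul_sum]
      exact Finset.sum_congr rfl fun j _ => by ring
    rw [h', h']
  · intro z hz
    have hX (q : Ph d) (hq : (Z q).re = 0) :
        hamVF G q = scale (kickRate cut o m a b ε q) q := hamVF_kickHam hcut hε hq
    have hrate (q : Ph d) (j : Fin d) : |c * kickRate cut o m a b ε q j| ≤ 1 / 4 := by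
      rw [abs_mul, abs_of_nonneg c.coe_nonneg]
      exact (mul_le_mul_of_nonneg_left (hM q j) c.coe_nonneg).trans hcM
    have hZs (μ : Fin d → ℝ) (q : Ph d) : Z (scale μ q) = (μ o ^ a * μ m ^ b : ℝ) * Z q :=
      resMon_scale μ q
    set S : Set (Ph d) := (fun μ => scale μ z) ''
      (Set.univ.pi fun _ : Fin d => Icc (1 / 2 : ℝ) (3 / 2)) with hS
    have hScomp : IsCompact S := by
      refine (isCompact_univ_pi fun _ => isCompact_Icc).image ?_
      unfold scale; fun_prop
    have hmaps : MapsTo (fun q => z + (c : ℝ) • hamVF G q) S S := by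
      rintro _ ⟨μ, hμ, rfl⟩
      have h0 : (Z (scale μ z)).re = 0 := by rw [hZs, Complex.re_ofReal_mul, hz, mul_zero]
      refine ⟨1 + fun j => c * kickRate cut o m a b ε (scale μ z) j * μ j, fun j _ => ?_, ?_⟩
      · have h1 := abs_le.1 (hrate (scale μ z) j)
        have h2 := hμ j (mem_univ j)
        simp only [Pi.add_apply, Pi.one_apply, mem_Icc] at h2 ⊢
        constructor <;> nlinarith
      · simp only [hX _ h0]
        ext i <;> simp [scale] <;> ring
    have hlip : LipschitzWith (c * K) fun q => z + (c : ℝ) • hamVF G q := by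
      refine LipschitzWith.of_dist_le_mul fun x y => ?_
      rw [dist_add_left, dist_smul₀, NNReal.norm_eq, NNReal.coe_mul, mul_assoc]
      exact mul_le_mul_of_nonneg_left (hK.dist_le_mul x y) c.coe_nonneg
    obtain ⟨q, ⟨μ, hμ, hμq⟩, hfix, -⟩ := ContractingWith.exists_fixedPoint' hScomp.isComplete
      hmaps (K := c * K) ⟨hcK, LipschitzWith.of_dist_le_mul fun x y => hlip.dist_le_mul x y⟩
      (x := z) ⟨1, fun j _ => by norm_num, by ext <;> simp [scale]⟩ (edist_ne_top _ _)
    have hqz : A q = z := by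
      rw [hA, sub_eq_iff_eq_add]; exact hfix.symm
    have hqA : A.symm z = q := by rw [← hqz, A.symm_apply_apply]
    have hqre : (Z q).re = 0 := by
      rw [← hμq, hZs, Complex.re_ofReal_mul, hz, mul_zero]
    set r := kickRate cut o m a b ε q with hr
    have hzq : z = scale (1 + (-(c : ℝ)) • r) q := by
      rw [← hqz, hA, hX q hqre, ← add_smul_scale, neg_smul, sub_eq_add_neg]
    have hgq : g z = scale (1 + (c : ℝ) • r) q := by
      rw [← hqz, hgA, hX q hqre, add_smul_scale]
    have hpos (e : ℝ) (he : e = c ∨ e = -c) (j : Fin d) : 0 < (1 + e • r) j := by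
      have := abs_le.1 (hrate q j)
      rcases he with rfl | rfl <;> simp only [Pi.add_apply, Pi.one_apply, Pi.smul_apply,
        smul_eq_mul] <;> linarith
    have him (e : ℝ) (he : e = c ∨ e = -c) : ∃ f : ℝ, 0 < f ∧
        (Z (scale (1 + e • r) q)).im = f * (Z q).im :=
      ⟨_, mul_pos (pow_pos (hpos e he o) a) (pow_pos (hpos e he m) b), by
        rw [hZs, Complex.im_ofReal_mul]⟩
    obtain ⟨f₁, hf₁, h₁⟩ := him (-c) (Or.inr rfl)
    obtain ⟨f₂, hf₂, h₂⟩ := him c (Or.inl rfl)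
    rw [← hzq] at h₁
    rw [← hgq] at h₂
    beta_reduce
    rw [hqA, h₁, h₂]
    refine ⟨by rw [hgq, hZs, Complex.re_ofReal_mul, hqre, mul_zero], fun σ hσ => ?_,
      fun j => ?_, fun hcz hi => ?_⟩
    · have h3 : 0 ≤ σ * (Z q).im := by
        refine nonneg_of_mul_nonneg_right (a := f₁) ?_ hf₁
        linarith
      constructor
      · calc 0 ≤ f₂ * (σ * (Z q).im) := by positivity
          _ = _ := by ring
      · calc 0 ≤ 2 * c * cut q * (σ * (Z q).im) :=
            mul_nonneg (mul_nonneg (by positivity) (hcut.nonneg q)) h3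
          _ = _ := by ring
    · rw [hgq, actJ_scale]
      conv_rhs => rw [hzq, actJ_scale]
      by_cases hq : cut q = 0
      · simp [hr, kickRate, hq]
      have hj : actJ j q ≠ 0 := (hcut.pos.trans (hcut.lt_actJ q hq j)).ne'
      simp only [Pi.add_apply, Pi.one_apply, Pi.smul_apply, smul_eq_mul, hr, kickRate]
      field_simp
      ring
    · have hcq : cut q ≠ 0 := by
        intro h
        apply hcz
        rw [← hqz, hA, hamVF_kickHam_of_cut_eq_zero hcut h, smul_zero, sub_zero, h]
      have h3 : 0 < (Z q).im := pos_of_mul_pos_right hi hf₁.le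
      have := (hcut.nonneg q).lt_of_ne' hcq
      positivity

end kick

/-- The neighbourhood of the axes and of infinity where some action is smaller than `η` or
the total action is larger than `1 / η`. -/
def escSet (d : ℕ) (η : ℝ) : Set (Ph d) := {p | (∃ i, actJ i p < η) ∨ 1 / η < ∑ i, actJ i p}

theorem notMem_escSet {d : ℕ} {η : ℝ} {p : Ph d} :
    p ∉ escSet d η ↔ (∀ i, η ≤ actJ i p) ∧ ∑ i, actJ i p ≤ 1 / η := by
  simp [escSet]

theorem escSet_mono {d : ℕ} {η η' : ℝ} (h0 : 0 < η) (h : η ≤ η') :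
    escSet d η ⊆ escSet d η' := by
  rintro p (⟨i, hi⟩ | hp)
  · exact Or.inl ⟨i, hi.trans_le h⟩
  · exact Or.inr ((one_div_le_one_div_of_le h0 h).trans_lt hp)

theorem isOpen_escSet {d : ℕ} {η : ℝ} : IsOpen (escSet d η) := by
  have : escSet d η = (⋃ i, {p | actJ i p < η}) ∪ {p | 1 / η < ∑ i, actJ i p} := by
    ext; simp [escSet]
  rw [this]
  exact (isOpen_iUnion fun i => isOpen_lt (continuous_actJ i) continuous_const).union
    (isOpen_lt continuous_const (continuous_finsetSum _ fun i _ => continuous_actJ i))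

theorem norm_le_of_sum_actJ_le {d : ℕ} {R : ℝ} {p : Ph d} (h : ∑ i, actJ i p ≤ R) :
    ‖p‖ ≤ 1 + 2 * R := by
  have hR : 0 ≤ R := (Finset.sum_nonneg fun i _ => actJ_nonneg i p).trans h
  have hi (i : Fin d) : p.1 i ^ 2 + p.2 i ^ 2 ≤ 2 * R := by
    have := (Finset.single_le_sum (f := fun i => actJ i p) (fun i _ => actJ_nonneg i p)
      (Finset.mem_univ i)).trans h
    simp only [actJ] at this
    linarith
  have hx (x y : ℝ) (h : x ^ 2 + y ^ 2 ≤ 2 * R) : |x| ≤ 1 + 2 * R :=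
    abs_le.2 ⟨by nlinarith [sq_nonneg (x + 1), sq_nonneg y], by
      nlinarith [sq_nonneg (x - 1), sq_nonneg y]⟩
  refine max_le ((pi_norm_le_iff_of_nonneg (by linarith)).2 fun i => hx _ _ (hi i))
    ((pi_norm_le_iff_of_nonneg (by linarith)).2 fun i => hx _ (p.1 i) ?_)
  rw [add_comm]; exact hi i

theorem isCompact_compl_escSet {d : ℕ} {η : ℝ} : IsCompact (escSet d η)ᶜ :=
  (isCompact_closedBall (0 : Ph d) (1 + 2 * (1 / η))).of_isClosed_subset
    isOpen_escSet.isClosed_compl fun _ hp =>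
      mem_closedBall_zero_iff.2 (norm_le_of_sum_actJ_le (notMem_escSet.1 hp).2)

theorem exists_cutoff {d : ℕ} (s : Fin d) {v c : ℝ} (hv : 0 < v) (hc : 0 < c) :
    ∃ cut : Ph d → ℝ, IsCutoff cut (v / 2) ∧ (∀ p ∈ escSet d (v / 2), cut p = 0) ∧
      (∀ p, 3 / 10 * c < |actJ s p - c| → cut p = 0) ∧
      ∀ p, p ∉ escSet d v → |actJ s p - c| ≤ c / 4 → cut p ≠ 0 := by
  let χ : ContDiffBump c := ⟨c / 4, 3 / 10 * c, by linarith, by linarith⟩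
  have hlow (p : Ph d) (i : Fin d) (hi : actJ i p ≤ v / 2) :
      ∏ i, expNegInvGlue (actJ i p - v / 2) = 0 :=
    Finset.prod_eq_zero (Finset.mem_univ i) (expNegInvGlue.zero_of_nonpos (by linarith))
  have hhigh (p : Ph d) (hp : 1 / (v / 2) ≤ ∑ i, actJ i p) :
      expNegInvGlue (1 / (v / 2) - ∑ i, actJ i p) = 0 :=
    expNegInvGlue.zero_of_nonpos (by linarith)
  refine ⟨fun p => (∏ i, expNegInvGlue (actJ i p - v / 2)) *
    expNegInvGlue (1 / (v / 2) - ∑ i, actJ i p) * χ (actJ s p),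
    ⟨?_, ?_, ?_, ?_, ?_, ?_⟩, ?_, ?_, ?_⟩
  · refine (ContDiff.mul ?_ ?_).mul (χ.contDiff.comp (contDiff_actJ s))
    · exact contDiff_prod fun i _ => expNegInvGlue.contDiff.comp
        ((contDiff_actJ i).sub contDiff_const)
    · exact expNegInvGlue.contDiff.comp
        (contDiff_const.sub (ContDiff.sum fun i _ => contDiff_actJ i))
  · refine HasCompactSupport.intro (isCompact_closedBall 0 (1 + 2 * (1 / (v / 2)))) fun p hp => ?_
    rw [hhigh p, mul_zero, zero_mul]
    by_contra! h
    exact hp (mem_closedBall_zero_iff.2 (norm_le_of_sum_actJ_le h.le))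
  · exact fun p => mul_nonneg (mul_nonneg (Finset.prod_nonneg fun i _ => expNegInvGlue.nonneg _)
      (expNegInvGlue.nonneg _)) χ.nonneg
  · intro τ p; simp only [actJ_rot]
  · positivity
  · intro p hp j
    by_contra! h
    exact hp (by rw [hlow p j h, zero_mul, zero_mul])
  · rintro p (⟨i, hi⟩ | hp)
    · beta_reduce
      rw [hlow p i hi.le, zero_mul, zero_mul]
    · beta_reduce
      rw [hhigh p hp.le, mul_zero, zero_mul]
  · intro p hp
    beta_reduce
    rw [χ.zero_of_le_dist (by rw [Real.dist_eq]; exact hp.le), mul_zero]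
  · intro p hp hs
    rw [notMem_escSet] at hp
    refine mul_ne_zero (mul_ne_zero (Finset.prod_ne_zero_iff.2 fun i _ => ?_) ?_) ?_
    · exact (expNegInvGlue.pos_of_pos (by linarith [hp.1 i])).ne'
    · have : 1 / v < 1 / (v / 2) := one_div_lt_one_div_of_lt (by linarith) (by linarith)
      exact (expNegInvGlue.pos_of_pos (by linarith [hp.2])).ne'
    · rw [χ.one_of_mem_closedBall (by rw [mem_closedBall, Real.dist_eq]; exact hs)]
      exact one_ne_zero

/-- A symplectic map, commuting with the resonant rotations, which pushes into `escSet d v`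
a suitable point of each resonant orbit in the zone `|r_s - c| ≤ c / 4`. -/
theorem exists_pusher {d : ℕ} {o m s : Fin d} (hom : m ≠ o) (hso : s ≠ o) (hsm : s ≠ m)
    {a b : ℕ} (ha : 0 < a) {ε v c : ℝ} (hε : ε = 1 ∨ ε = -1) (hv : 0 < v) (hc : 0 < c) :
    ∃ h : Equiv.Perm (Ph d), IsSymplecto h ∧ (∀ p ∈ escSet d (v / 2), h p = p) ∧
      (∀ p, 3 / 10 * c < |actJ s p - c| → h p = p) ∧
      (∀ τ : Fin d → ℝ, a * τ o + ε * b * τ m = 0 → ∀ z, h (rot τ z) = rot τ (h z)) ∧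
      (∀ ν : Fin d → ℝ, a * ν o + ε * b * ν m = 0 →
        ∀ z, ∑ j, ν j * actJ j (h z) = ∑ j, ν j * actJ j z) ∧
      ∀ q, |actJ s q - c| ≤ c / 4 → ∃ σ : ℝ, (σ = 1 ∨ σ = -1) ∧
        ∀ q', (∀ j, actJ j q' = actJ j q) → (resMon o m a b ε q').re = 0 →
          0 ≤ σ * (resMon o m a b ε q').im → h q' ∈ escSet d v := by
  obtain ⟨cut, hcut, hcut_esc, hcut_zone, hcut_ne⟩ := exists_cutoff s hv hc
  obtain ⟨g, w, hg, hw, hgcut, hgrot, hgact, hgline⟩ :=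
    exists_kick (o := o) (m := m) (a := a) (b := b) hcut hε
  set Z := resMon (d := d) o m a b ε with hZ
  set k := resVec o m a b ε with hk
  have hZc : Continuous Z := (contDiff_resMon (n := 0)).continuous
  have hrotN (n : ℕ) (τ : Fin d → ℝ) (hτ : a * τ o + ε * b * τ m = 0) (z : Ph d) :
      (g ^ n) (rot τ z) = rot τ ((g ^ n) z) := by
    induction n with
    | zero => rfl
    | succ n ih => rw [pow_succ', Equiv.Perm.mul_apply, ih, hgrot τ hτ, Equiv.Perm.mul_apply]
  have hactN (n : ℕ) (ν : Fin d → ℝ) (hν : a * ν o + ε * b * ν m = 0) (z : Ph d) :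
      ∑ j, ν j * actJ j ((g ^ n) z) = ∑ j, ν j * actJ j z := by
    induction n with
    | zero => rfl
    | succ n ih => rw [pow_succ', Equiv.Perm.mul_apply, hgact ν hν, ih]
  have hgs (n : ℕ) (z : Ph d) : actJ s ((g ^ n) z) = actJ s z := by
    simpa [Pi.single_apply] using
      hactN n (Pi.single s 1) (by simp [hso.symm, hsm.symm]) z
  have horbit (σ : ℝ) (z : Ph d) (hre : (Z z).re = 0) (him : 0 ≤ σ * (Z z).im) (n : ℕ) :
      (Z ((g ^ n) z)).re = 0 ∧ 0 ≤ σ * (Z ((g ^ n) z)).im ∧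
      ∀ j, actJ j ((g ^ n) z) = actJ j z - k j * ∑ i ∈ Finset.range n, w ((g ^ i) z) := by
    induction n with
    | zero => exact ⟨hre, him, fun j => by simp⟩
    | succ n ih =>
      obtain ⟨h1, h2, h3⟩ := ih
      obtain ⟨h4, h5, h6, -⟩ := hgline _ h1
      rw [pow_succ', Equiv.Perm.mul_apply]
      refine ⟨h4, (h5 σ h2).1, fun j => ?_⟩
      rw [h6, h3, Finset.sum_range_succ]
      ring
  have hwpos (σ : ℝ) (z : Ph d) (hre : (Z z).re = 0) (him : 0 ≤ σ * (Z z).im) (n : ℕ) :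
      0 ≤ σ * w ((g ^ n) z) :=
    ((hgline _ (horbit σ z hre him n).1).2.1 σ (horbit σ z hre him n).2.1).2
  have hWpos (σ : ℝ) (z : Ph d) (hre : (Z z).re = 0) (him : 0 ≤ σ * (Z z).im) (n : ℕ) :
      0 ≤ σ * ∑ i ∈ Finset.range n, w ((g ^ i) z) := by
    rw [Finset.mul_sum]
    exact Finset.sum_nonneg fun i _ => hwpos σ z hre him i
  set C : Set (Ph d) := (escSet d v)ᶜ ∩ {z | |actJ s z - c| ≤ c / 4 ∧ (Z z).re = 0 ∧ 0 ≤ (Z z).im}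
    with hCdef
  obtain ⟨κ, hκ0, hκ⟩ : ∃ κ > 0, ∀ z ∈ C, κ ≤ w z := by
    rcases C.eq_empty_or_nonempty with hC | hC
    · exact ⟨1, one_pos, by simp [hC]⟩
    · have hCc : IsCompact C := isCompact_compl_escSet.inter_right <|
        (isClosed_le ((continuous_actJ s).sub continuous_const).abs continuous_const).inter <|
        (isClosed_eq (Complex.continuous_re.comp hZc) continuous_const).inter
          (isClosed_le continuous_const (Complex.continuous_im.comp hZc))
      obtain ⟨z, hz, hmin⟩ := hCc.exists_isMinOn hC hw.continuousOn
      refine ⟨w z, ?_, fun z' hz' => hmin hz'⟩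
      obtain ⟨hz1, hz2, hz3, hz4⟩ := hz
      have hz1' := (notMem_escSet.1 hz1).1
      refine (hgline z hz3).2.2.2 (hcut_ne z hz1 hz2) (hz4.lt_of_ne fun h => ?_)
      exact resMon_ne_zero (a := a) (b := b) hε (hv.trans_le (hz1' o)).ne'
        (hv.trans_le (hz1' m)).ne' (Complex.ext hz3 h.symm)
  obtain ⟨N, hN⟩ := exists_nat_gt (1 / v / κ)
  rw [div_lt_iff₀ hκ0] at hN
  refine ⟨g ^ N, hg.pow N, ?_, ?_, fun τ hτ z => hrotN N τ hτ z, fun ν hν z => hactN N ν hν z, ?_⟩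
  · intro p hp
    exact Function.IsFixedPt.perm_pow (hgcut p (hcut_esc p hp)) N
  · intro p hp
    exact Function.IsFixedPt.perm_pow (hgcut p (hcut_zone p hp)) N
  · intro q hq
    have hsign (x : ℝ) : ∃ σ : ℝ, (σ = 1 ∨ σ = -1) ∧ 0 ≤ σ * x := by
      rcases le_total 0 x with hx | hx
      · exact ⟨1, Or.inl rfl, by linarith⟩
      · exact ⟨-1, Or.inr rfl, by linarith⟩
    by_cases hqv : q ∈ escSet d v
    · rcases hqv with ⟨i, hi⟩ | hqv
      · obtain ⟨σ, hσ, hσi⟩ := hsign (k i)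
        refine ⟨σ, hσ, fun q' hq' hre him => Or.inl ⟨i, ?_⟩⟩
        rw [(horbit σ q' hre him N).2.2, hq']
        have := mul_nonneg hσi (hWpos σ q' hre him N)
        rcases hσ with rfl | rfl <;> linarith
      · obtain ⟨σ, hσ, hσi⟩ := hsign (-∑ i, k i)
        refine ⟨σ, hσ, fun q' hq' hre him => Or.inr ?_⟩
        simp only [(horbit σ q' hre him N).2.2, hq', Finset.sum_sub_distrib, ← Finset.sum_mul]
        have := mul_nonneg hσi (hWpos σ q' hre him N)
        rcases hσ with rfl | rfl <;> linarith
    · refine ⟨1, Or.inl rfl, fun q' hq' hre him => ?_⟩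
      by_contra hN'
      rw [notMem_escSet] at hqv hN'
      have hstay (n : ℕ) (hn : n ≤ N) : (g ^ n) q' ∉ escSet d v := by
        have h0 := hWpos 1 q' hre him n
        have h1 : 0 ≤ ∑ i ∈ Finset.range N, w ((g ^ i) q') - ∑ i ∈ Finset.range n, w ((g ^ i) q') :=
          sub_nonneg.2 <| Finset.sum_le_sum_of_subset_of_nonneg
            (Finset.range_subset_range.2 hn) fun i _ _ => by simpa using hwpos 1 q' hre him i
        have hj (x y u e f : ℝ) (hx : x ≤ y) (h : x ≤ y - u * f) (he : 0 ≤ e) (hef : 0 ≤ f - e) :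
            x ≤ y - u * e := by
          rcases le_total 0 u with hu | hu <;> nlinarith
        rw [notMem_escSet]
        constructor
        · intro j
          have h2 := hN'.1 j
          rw [(horbit 1 q' hre him _).2.2] at h2 ⊢
          refine hj _ _ _ _ _ ?_ h2 (by linarith) h1
          rw [hq']
          exact hqv.1 j
        · have h2 := hN'.2
          simp only [(horbit 1 q' hre him _).2.2, Finset.sum_sub_distrib, ← Finset.sum_mul] at h2 ⊢
          have h3 : ∑ j, actJ j q' ≤ 1 / v := by simpa only [hq'] using hqv.2
          have := hj (-(1 / v)) (-∑ j, actJ j q') (-∑ j, k j)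
            (∑ i ∈ Finset.range n, w ((g ^ i) q')) (∑ i ∈ Finset.range N, w ((g ^ i) q'))
            (by linarith) (by linarith) (by linarith) h1
          linarith
      have hsum : N * κ ≤ ∑ i ∈ Finset.range N, w ((g ^ i) q') := by
        simpa using Finset.card_nsmul_le_sum (Finset.range N) (fun i => w ((g ^ i) q')) κ
          fun i hi => hκ _ ⟨hstay i (Finset.mem_range.1 hi).le, by rw [hgs, hq']; exact hq,
            (horbit 1 q' hre him i).1, by simpa using (horbit 1 q' hre him i).2.1⟩
      have h1 := hN'.1 o
      rw [(horbit 1 q' hre him _).2.2, hk, resVec_left hom, hq'] at h1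
      have h2 : actJ o q ≤ 1 / v :=
        (Finset.single_le_sum (f := fun i => actJ i q) (fun i _ => actJ_nonneg i q)
          (Finset.mem_univ o)).trans hqv.2
      have h3 : (1 : ℝ) ≤ a := by exact_mod_cast ha
      have h4 : 0 ≤ N * κ := by positivity
      nlinarith

section Limits

variable {E : Type*} [NormedAddCommGroup E] [NormedSpace ℝ E]

theorem exists_local_limit [HasContDiffBump E] {H : ℕ → E → ℝ} (hH : ∀ n, ContDiff ℝ (⊤ : ℕ∞) (H n))
    {U : Set E} (hU : IsOpen U) {χ : E → ℝ} (hχ : ContDiff ℝ (⊤ : ℕ∞) χ) (hχU : ∀ p ∈ U, χ p = 1)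
    (hclose : ∀ k, ∀ᶠ n in atTop, ∀ p,
      ‖iteratedFDeriv ℝ k (fun p => χ p * (H (n + 1) p - H n p)) p‖ ≤ (1 / 2) ^ n) :
    ∃ S : E → ℝ, ContDiff ℝ (⊤ : ℕ∞) S ∧
      (∀ p ∈ U, Tendsto (fun n => H n p) atTop (𝓝 (S p))) ∧
      (∀ p ∈ U, Tendsto (fun y : ℕ × E => fderiv ℝ (H y.1) y.2) (atTop ×ˢ 𝓝 p)
        (𝓝 (fderiv ℝ S p))) ∧
      (0 ∈ U → (∀ n, H (n + 1) =ᶠ[𝓝 0] H n) →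
        ∀ k ≤ 2, iteratedFDeriv ℝ k (fun p => S p - H 0 p) 0 = 0) := by
  obtain ⟨N, hN⟩ := eventually_atTop.1 ((hclose 0).and ((hclose 1).and (hclose 2)))
  set f : ℕ → E → ℝ := fun k p => χ p * (H (N + k + 1) p - H (N + k) p) with hf
  have hfs (k : ℕ) : ContDiff ℝ (⊤ : ℕ∞) (f k) := hχ.mul ((hH _).sub (hH _))
  have hpow (k : ℕ) : (1 / 2 : ℝ) ^ (N + k) ≤ (1 / 2) ^ k :=
    pow_le_pow_of_le_one (by norm_num) (by norm_num) (by omega)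
  have hv : Summable fun n : ℕ => (1 / 2 : ℝ) ^ n := summable_geometric_two
  have h0 (k : ℕ) (p : E) : ‖f k p‖ ≤ (1 / 2) ^ k := by
    rw [← norm_iteratedFDeriv_zero (𝕜 := ℝ) (f := f k)]
    exact ((hN (N + k) (by omega)).1 p).trans (hpow k)
  have h1 (k : ℕ) (p : E) : ‖fderiv ℝ (f k) p‖ ≤ (1 / 2) ^ k := by
    rw [← norm_iteratedFDeriv_one]
    exact ((hN (N + k) (by omega)).2.1 p).trans (hpow k)
  have hsum (p : E) : Summable fun k => f k p := .of_norm_bounded hv fun k => h0 k p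
  have hpart (n : ℕ) {p : E} (hp : p ∈ U) :
      H (N + n) p = H N p + ∑ k ∈ Finset.range n, f k p := by
    simp only [hf, hχU p hp, one_mul]
    have := Finset.sum_range_sub (fun k => H (N + k) p) n
    simp only [← add_assoc, add_zero] at this
    rw [this]; ring
  have hts : ContDiff ℝ (⊤ : ℕ∞) fun p => ∑' k, f k p := by
    refine contDiff_tsum_of_eventually (v := fun _ n => (1 / 2 : ℝ) ^ n) hfs (fun _ _ => hv) ?_
    intro k _
    rw [Nat.cofinite_eq_atTop]
    filter_upwards [(tendsto_add_atTop_nat N).eventually (hclose k)] with n hn p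
    rw [add_comm n N] at hn
    exact (hn p).trans (hpow n)
  have hder (p : E) : fderiv ℝ (fun p => H N p + ∑' k, f k p) p =
      fderiv ℝ (H N) p + ∑' k, fderiv ℝ (f k) p := by
    rw [fderiv_fun_add ((hH N).differentiable (by simp) p) (hts.differentiable (by simp) p),
      fderiv_tsum_apply hv (fun k => (hfs k).differentiable (by simp)) h1 (hsum 0)]
  refine ⟨fun p => H N p + ∑' k, f k p, (hH N).add hts, fun p hp => ?_, fun p hp => ?_,
    fun _ hflat k hk => ?_⟩
  · rw [← tendsto_add_atTop_iff_nat N]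
    simp only [add_comm _ N, hpart _ hp]
    exact tendsto_const_nhds.add (hsum p).hasSum.tendsto_sum_nat
  · have hcont : Continuous fun p => fderiv ℝ (fun p => H N p + ∑' k, f k p) p :=
      ((hH N).add hts).continuous_fderiv (by simp)
    have hunif := tendstoUniformly_tsum_nat hv h1
    rw [Metric.tendsto_nhds]
    intro e he
    have hA := Metric.tendstoUniformly_iff.1 hunif (e / 2) (by linarith)
    have hB := Metric.tendsto_nhds.1 (hcont.tendsto p) (e / 2) (by linarith)
    obtain ⟨M, hM⟩ := eventually_atTop.1 hA
    filter_upwards [(eventually_ge_atTop (N + M)).prod_mk (hB.and (hU.mem_nhds hp))] with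
      ⟨n, y⟩ ⟨hn, hy, hyU⟩
    dsimp only at hn hy hyU ⊢
    obtain ⟨n, rfl⟩ := Nat.exists_eq_add_of_le hn
    have hHn : fderiv ℝ (H (N + (M + n))) y =
        fderiv ℝ (H N) y + ∑ k ∈ Finset.range (M + n), fderiv ℝ (f k) y := by
      have : H (N + (M + n)) =ᶠ[𝓝 y] fun p => H N p + ∑ k ∈ Finset.range (M + n), f k p :=
        (hU.eventually_mem hyU).mono fun z hz => hpart _ hz
      rw [this.fderiv_eq, fderiv_fun_add ((hH N).differentiable (by simp) y),
        fderiv_fun_sum fun k _ => (hfs k).differentiable (by simp) y]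
      exact DifferentiableAt.fun_sum fun k _ => (hfs k).differentiable (by simp) y
    have hM' := hM (M + n) (by omega) y
    refine (dist_triangle _ (fderiv ℝ (fun p => H N p + ∑' k, f k p) y) _).trans_lt ?_
    rw [add_assoc, hHn, hder y, dist_add_left, dist_comm, ← hder]
    linarith
  · have hf0 (k : ℕ) : f k =ᶠ[𝓝 0] 0 := (hflat (N + k)).mono fun p hp => by
      simp [hf, hp]
    have hH0 (n : ℕ) : H n =ᶠ[𝓝 0] H 0 := by
      induction n with
      | zero => exact EventuallyEq.rfl
      | succ n ih => exact (hflat n).trans ih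
    have heq : (fun p => H N p + (∑' k, f k p) - H 0 p) =ᶠ[𝓝 0] fun p => ∑' k, f k p :=
      (hH0 N).mono fun p hp => by simp [hp]
    rw [(EventuallyEq.iteratedFDeriv ℝ heq k).eq_of_nhds]
    rw [iteratedFDeriv_tsum_apply (N := 2) (v := fun _ n => (1 / 2 : ℝ) ^ n)
      (fun i => (hfs i).of_le (by exact_mod_cast le_top)) (fun _ _ => hv) ?_ (by exact_mod_cast hk)]
    · convert! tsum_zero with i
      rw [(EventuallyEq.iteratedFDeriv ℝ (hf0 i) k).eq_of_nhds]
      simp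
    · intro k i x hk
      have hk' : k ≤ 2 := by exact_mod_cast hk
      have := hN (N + i) (by omega)
      refine (?_ : _ ≤ _).trans (hpow i)
      interval_cases k
      exacts [this.1 x, this.2.1 x, this.2.2 x]

end Limits

/-- A smooth function of compact support equal to one on the ball of radius `R`. -/
def ballBump (d R : ℕ) : ContDiffBump (0 : Ph d) :=
  ⟨R + 1, R + 2, by positivity, by linarith⟩

/-- `e`-closeness of Hamiltonians and flows: in `C^n` on the ball of radius `n` for the
Hamiltonians, and up to time `T` on the same ball for the flows. -/
structure IsClose {d : ℕ} (n : ℕ) (T e : ℝ) (H H' : Ph d → ℝ) (φ φ' : ℝ → Ph d → Ph d) :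
    Prop where
  ham : ∀ R ≤ n, ∀ k ≤ n, ∀ p,
    ‖iteratedFDeriv ℝ k (fun p => ballBump d R p * (H' p - H p)) p‖ ≤ e
  flat : H' =ᶠ[𝓝 0] H
  flow : ∀ t p, |t| ≤ T → ‖p‖ ≤ n → dist (φ t p) (φ' t p) ≤ e

theorem exists_smooth_limit {d : ℕ} {H : ℕ → Ph d → ℝ} (hH : ∀ n, ContDiff ℝ (⊤ : ℕ∞) (H n))
    (hclose : ∀ n, ∀ R ≤ n, ∀ k ≤ n, ∀ p,
      ‖iteratedFDeriv ℝ k (fun p => ballBump d R p * (H (n + 1) p - H n p)) p‖ ≤ (1 / 2) ^ n)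
    (hflat : ∀ n, H (n + 1) =ᶠ[𝓝 0] H n) :
    ∃ L : Ph d → ℝ, ContDiff ℝ (⊤ : ℕ∞) L ∧
      (∀ p, Tendsto (fun y : ℕ × Ph d => fderiv ℝ (H y.1) y.2) (atTop ×ˢ 𝓝 p)
        (𝓝 (fderiv ℝ L p))) ∧
      ∀ k ≤ 2, iteratedFDeriv ℝ k (fun p => L p - H 0 p) 0 = 0 := by
  have hloc (R : ℕ) := exists_local_limit hH (U := ball 0 (R + 1)) isOpen_ball
    (ballBump d R).contDiff
    (fun p hp => (ballBump d R).one_of_mem_closedBall (ball_subset_closedBall hp))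
    fun k => (eventually_ge_atTop (max R k)).mono fun n hn =>
      hclose n R (le_of_max_le_left hn) k (le_of_max_le_right hn)
  choose S hS hlim hder hSflat using hloc
  set L : Ph d → ℝ := fun p => S ⌊‖p‖⌋₊ p with hL
  have hmem (p : Ph d) : p ∈ ball (0 : Ph d) (⌊‖p‖⌋₊ + 1) :=
    mem_ball_zero_iff.2 (Nat.lt_floor_add_one _)
  have hLS (R : ℕ) {p : Ph d} (hp : p ∈ ball (0 : Ph d) (R + 1)) : L p = S R p :=
    tendsto_nhds_unique (hlim _ p (hmem p)) (hlim R p hp)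
  have hLev (p : Ph d) : L =ᶠ[𝓝 p] S ⌊‖p‖⌋₊ :=
    (isOpen_ball.eventually_mem (hmem p)).mono fun q hq => hLS _ hq
  have h0 : (0 : Ph d) ∈ ball (0 : Ph d) ((0 : ℕ) + 1) := by simp
  refine ⟨L, ?_, fun p => ?_, fun k hk => ?_⟩
  · exact contDiff_iff_contDiffAt.2 fun p => (hS _).contDiffAt.congr_of_eventuallyEq (hLev p)
  · rw [(hLev p).fderiv_eq]
    exact hder _ p (hmem p)
  · have : (fun p => L p - H 0 p) =ᶠ[𝓝 0] fun p => S 0 p - H 0 p :=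
      (isOpen_ball.eventually_mem h0).mono fun p hp => by simp only [hLS 0 hp]
    rw [(EventuallyEq.iteratedFDeriv ℝ this k).eq_of_nhds]
    exact hSflat 0 h0 hflat k hk

theorem tendsto_hamVF {d : ℕ} {ι : Type*} {l : Filter ι} {H : ι → Ph d → ℝ} {L : Ph d → ℝ}
    {q : ι → Ph d} {p : Ph d}
    (h : Tendsto (fun i => fderiv ℝ (H i) (q i)) l (𝓝 (fderiv ℝ L p))) :
    Tendsto (fun i => hamVF (H i) (q i)) l (𝓝 (hamVF L p)) :=
  (tendsto_pi_nhds.2 fun _ =>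
      ((ContinuousLinearMap.apply ℝ ℝ _).continuous.tendsto _).comp h).prodMk_nhds
    (tendsto_pi_nhds.2 fun _ =>
      (((ContinuousLinearMap.apply ℝ ℝ _).continuous.tendsto _).comp h).neg)

/-- Limits of Hamiltonian flows along a fast converging sequence of Hamiltonians. -/
theorem exists_flow_limit {d : ℕ} {H : ℕ → Ph d → ℝ} {φ : ℕ → ℝ → Ph d → Ph d} {T : ℕ → ℝ}
    (hH : ∀ n, ContDiff ℝ (⊤ : ℕ∞) (H n)) (hφ : ∀ n, IsGlobalFlow (H n) (φ n))
    (hcont : ∀ n, Continuous fun y : ℝ × Ph d => φ n y.1 y.2) (hT : Monotone T) (hT0 : 0 ≤ T 0)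
    (hclose : ∀ n : ℕ, IsClose n (n + T n) ((1 / 2) ^ n) (H n) (H (n + 1)) (φ n) (φ (n + 1))) :
    ∃ (L : Ph d → ℝ) (ψ : ℝ → Ph d → Ph d), ContDiff ℝ (⊤ : ℕ∞) L ∧
      (∀ k ≤ 2, iteratedFDeriv ℝ k (fun p => L p - H 0 p) 0 = 0) ∧ IsGlobalFlow L ψ ∧
      ∀ (n : ℕ) t p, |t| ≤ T n → ‖p‖ ≤ n → dist (φ n t p) (ψ t p) ≤ 2 * (1 / 2) ^ n := by
  obtain ⟨L, hL, hLder, hLflat⟩ := exists_smooth_limit hH (fun n => (hclose n).ham)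
    fun n => (hclose n).flat
  have hTn (n : ℕ) : 0 ≤ T n := hT0.trans (hT (Nat.zero_le n))
  have hstep {n : ℕ} {t : ℝ} {p : Ph d} (ht : |t| ≤ n + T n) (hp : ‖p‖ ≤ n) (k : ℕ) :
      dist (φ (n + k) t p) (φ (n + k + 1) t p) ≤ 2 * (1 / 2) ^ n / 2 / 2 ^ k := by
    refine ((hclose (n + k)).flow t p ?_ ?_).trans_eq ?_
    · have := hT (Nat.le_add_right n k)
      push_cast
      linarith [k.cast_nonneg (α := ℝ)]
    · push_cast
      linarith [k.cast_nonneg (α := ℝ)]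
    · rw [pow_add]
      simp only [one_div, inv_pow]
      field_simp
  have hex (t : ℝ) (p : Ph d) : ∃ q, Tendsto (fun n => φ n t p) atTop (𝓝 q) := by
    obtain ⟨n, hn⟩ := exists_nat_ge (max |t| ‖p‖)
    have hn' := (le_max_left _ _).trans hn
    obtain ⟨q, hq⟩ := cauchySeq_tendsto_of_complete <| cauchySeq_of_le_geometric_two
      (hstep (n := n) (t := t) (p := p) (by linarith [hTn n]) ((le_max_right _ _).trans hn))
    exact ⟨q, (tendsto_add_atTop_iff_nat n).1 (by simpa only [add_comm] using hq)⟩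
  choose ψ hψ using hex
  have hdist {n : ℕ} {t : ℝ} {p : Ph d} (ht : |t| ≤ n + T n) (hp : ‖p‖ ≤ n) :
      dist (φ n t p) (ψ t p) ≤ 2 * (1 / 2) ^ n :=
    dist_le_of_le_geometric_two_of_tendsto₀ (hstep ht hp)
      (by simpa only [add_comm] using (tendsto_add_atTop_iff_nat n).2 (hψ t p))
  have hloc : TendstoLocallyUniformly (fun n (y : ℝ × Ph d) => φ n y.1 y.2)
      (fun y => ψ y.1 y.2) atTop := by
    rw [Metric.tendstoLocallyUniformly_iff]
    intro e he y
    have hB : ball (0 : ℝ × Ph d) (‖y‖ + 1) ∈ 𝓝 y :=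
      isOpen_ball.mem_nhds (mem_ball_zero_iff.2 (by linarith))
    refine ⟨_, hB, ?_⟩
    have hpow : Tendsto (fun n : ℕ => 2 * (1 / 2 : ℝ) ^ n) atTop (𝓝 (2 * 0)) :=
      (tendsto_pow_atTop_nhds_zero_of_lt_one (by norm_num) (by norm_num)).const_mul 2
    filter_upwards [hpow.eventually_lt_const (by linarith : 2 * 0 < e),
      eventually_ge_atTop ⌈‖y‖ + 1⌉₊] with n hn hny z hz
    rw [mem_ball_zero_iff] at hz
    have hzn : ‖z‖ ≤ n := hz.le.trans (Nat.ceil_le.1 hny)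
    rw [dist_comm]
    have habs := (norm_fst_le z).trans hzn
    rw [Real.norm_eq_abs] at habs
    exact (hdist (by linarith [hTn n]) ((norm_snd_le z).trans hzn)).trans_lt hn
  have hψc : Continuous fun y : ℝ × Ph d => ψ y.1 y.2 :=
    hloc.continuous (Frequently.of_forall hcont)
  have hjoint (y : ℝ × Ph d) : Tendsto (fun x : ℕ × (ℝ × Ph d) => φ x.1 x.2.1 x.2.2)
      (atTop ×ˢ 𝓝 y) (𝓝 (ψ y.1 y.2)) := by
    have h1 := tendstoLocallyUniformly_iff_forall_tendsto.1 hloc y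
    have h2 : Tendsto (fun x : ℕ × (ℝ × Ph d) => ψ x.2.1 x.2.2) (atTop ×ˢ 𝓝 y) (𝓝 (ψ y.1 y.2)) :=
      (hψc.tendsto y).comp tendsto_snd
    exact h2.congr_uniformity h1
  refine ⟨L, ψ, hL, hLflat, ⟨fun p => ?_, fun s t p => ?_, fun p t => ?_⟩, fun n t p ht hp =>
    hdist (by linarith [n.cast_nonneg (α := ℝ)]) hp⟩
  · exact tendsto_nhds_unique (hψ 0 p) (by simp only [(hφ _).1, tendsto_const_nhds])
  · refine tendsto_nhds_unique (hψ (s + t) p) ?_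
    simp only [(hφ _).2.1]
    exact (hjoint (s, ψ t p)).comp
      (tendsto_id.prodMk (tendsto_const_nhds.prodMk_nhds (hψ t p)))
  · have hder : Tendsto (fun x : ℕ × ℝ => hamVF (H x.1) (φ x.1 x.2 p)) (atTop ×ˢ 𝓝 t)
        (𝓝 (hamVF L (ψ t p))) := by
      refine tendsto_hamVF ((hLder (ψ t p)).comp (tendsto_fst.prodMk ?_))
      exact (hjoint (t, p)).comp (tendsto_fst.prodMk (tendsto_snd.prodMk_nhds tendsto_const_nhds))
    refine hasDerivAt_of_tendstoUniformlyOnFilter (l := atTop) (f := fun n t => φ n t p)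
      (f' := fun n t => hamVF (H n) (φ n t p)) (g' := fun t => hamVF L (ψ t p)) ?_ ?_ ?_
    · rw [tendstoUniformlyOnFilter_iff_tendsto]
      have : Tendsto (fun x : ℕ × ℝ => hamVF L (ψ x.2 p)) (atTop ×ˢ 𝓝 t)
          (𝓝 (hamVF L (ψ t p))) := by
        refine Tendsto.comp (y := 𝓝 t) (g := fun t => hamVF L (ψ t p)) ?_ tendsto_snd
        exact ((contDiff_hamVF hL).continuous.comp
          (hψc.comp (Continuous.prodMk_left p))).tendsto t
      exact (this.prodMk_nhds hder).mono_right (nhds_le_uniformity _)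
    · exact Eventually.of_forall fun x => (hφ x.1).2.2 p x.2
    · exact Eventually.of_forall fun t => hψ t p

section Twist

variable {d : ℕ} {A : Fin d → ℝ → ℝ} {s m : Fin d} {e : ℝ → ℝ} {Φ : Equiv.Perm (Ph d)}

/-- The integrable Hamiltonian `∑ A_j(r_s) r_j`. -/
def twistHam (A : Fin d → ℝ → ℝ) (s : Fin d) (p : Ph d) : ℝ := ∑ j, A j (actJ s p) * actJ j p

/-- The frequencies of `twistHam`. -/
def twistFreq (A : Fin d → ℝ → ℝ) (s : Fin d) (p : Ph d) : Fin d → ℝ :=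
  (fun i => A i (actJ s p)) + Pi.single s (∑ l, deriv (A l) (actJ s p) * actJ l p)

/-- The flow of `twistHam`. -/
def twistFlow (A : Fin d → ℝ → ℝ) (s : Fin d) (t : ℝ) (p : Ph d) : Ph d :=
  rot (t • twistFreq A s p) p

theorem hasFDerivAt_twistHam (hA : ∀ j, ContDiff ℝ (⊤ : ℕ∞) (A j)) (p : Ph d) :
    HasFDerivAt (twistHam A s) (∑ j, twistFreq A s p j • dAct j p) p := by
  have h (j : Fin d) := (((hA j).differentiable (by simp) (actJ s p)).hasDerivAt.comp_hasFDerivAt p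
    (hasFDerivAt_actJ s p)).mul (hasFDerivAt_actJ j p)
  refine (HasFDerivAt.fun_sum fun j (_ : j ∈ Finset.univ) => h j).congr_fderiv ?_
  simp only [twistFreq, Pi.add_apply, add_smul, Finset.sum_add_distrib, Pi.single_apply, ite_smul,
    zero_smul, Finset.sum_ite_eq', Finset.mem_univ, if_true, Finset.sum_smul, Function.comp_apply]
  congr 1
  exact Finset.sum_congr rfl fun j _ => by rw [smul_smul, mul_comm]

theorem contDiff_twistHam (hA : ∀ j, ContDiff ℝ (⊤ : ℕ∞) (A j)) :
    ContDiff ℝ (⊤ : ℕ∞) (twistHam A s) :=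
  ContDiff.sum fun j _ => ((hA j).comp (contDiff_actJ s)).mul (contDiff_actJ j)

theorem twistFreq_congr {p q : Ph d} (h : ∀ j, actJ j q = actJ j p) :
    twistFreq A s q = twistFreq A s p := by
  simp only [twistFreq, h]

theorem actJ_twistFlow (j : Fin d) (t : ℝ) (p : Ph d) :
    actJ j (twistFlow A s t p) = actJ j p :=
  actJ_rot _ _ _

theorem continuous_twistFreq (hA : ∀ j, ContDiff ℝ (⊤ : ℕ∞) (A j)) :
    Continuous (twistFreq A s) := by
  refine (continuous_pi fun i => (hA i).continuous.comp (continuous_actJ s)).add ?_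
  refine (continuous_single (A := fun _ => ℝ) s).comp (continuous_finsetSum _ fun l _ => ?_)
  exact (((hA l).continuous_deriv (by simp)).comp (continuous_actJ s)).mul (continuous_actJ l)

theorem continuous_rot {X : Type*} [TopologicalSpace X] {f : X → Fin d → ℝ} {g : X → Ph d}
    (hf : Continuous f) (hg : Continuous g) : Continuous fun x => rot (f x) (g x) := by
  unfold rot
  fun_prop

/-- The conjugate of `twistHam` by `Φ`. -/
def conjHam (A : Fin d → ℝ → ℝ) (s : Fin d) (Φ : Equiv.Perm (Ph d)) : Ph d → ℝ :=
  twistHam A s ∘ Φ.symm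

/-- The flow of `conjHam`. -/
def conjFlow (A : Fin d → ℝ → ℝ) (s : Fin d) (Φ : Equiv.Perm (Ph d)) (t : ℝ) (p : Ph d) : Ph d :=
  Φ (twistFlow A s t (Φ.symm p))

theorem contDiff_conjHam (hA : ∀ j, ContDiff ℝ (⊤ : ℕ∞) (A j)) (hΦ : IsSymplecto Φ) :
    ContDiff ℝ (⊤ : ℕ∞) (conjHam A s Φ) :=
  (contDiff_twistHam hA).comp hΦ.smooth_symm

theorem isGlobalFlow_conjFlow (hA : ∀ j, ContDiff ℝ (⊤ : ℕ∞) (A j)) (hΦ : IsSymplecto Φ) :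
    IsGlobalFlow (conjHam A s Φ) (conjFlow A s Φ) := by
  refine ⟨fun p => ?_, fun t u p => ?_, fun p t => ?_⟩
  · simp [conjFlow, twistFlow, rot_zero]
  · have : twistFreq A s (twistFlow A s u (Φ.symm p)) = twistFreq A s (Φ.symm p) :=
      twistFreq_congr fun j => actJ_twistFlow j _ _
    simp only [conjFlow, Φ.symm_apply_apply]
    conv_rhs => rw [twistFlow, this, twistFlow, ← rot_add, ← add_smul]
    rfl
  · set q := twistFlow A s t (Φ.symm p) with hq
    have h1 := (hΦ.differentiable q).hasFDerivAt.comp_hasDerivAt t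
      (hasDerivAt_rot (twistFreq A s (Φ.symm p)) (Φ.symm p) t)
    refine h1.congr_deriv ?_
    rw [conjHam, conjFlow, hΦ.hamVF_comp_symm ((contDiff_twistHam hA).differentiable (by simp)),
      hamVF_of_hasFDerivAt (hasFDerivAt_twistHam hA q),
      twistFreq_congr fun j => actJ_twistFlow j _ _]
    rfl

theorem continuous_conjFlow (hA : ∀ j, ContDiff ℝ (⊤ : ℕ∞) (A j)) (hΦ : IsSymplecto Φ) :
    Continuous fun y : ℝ × Ph d => conjFlow A s Φ y.1 y.2 := by
  have h := hΦ.smooth_symm.continuous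
  exact hΦ.smooth.continuous.comp (continuous_rot
    (continuous_fst.smul ((continuous_twistFreq hA).comp (h.comp continuous_snd)))
    (h.comp continuous_snd))

/-- The family `A` with its `m`-th member modified by `δ e`. -/
def perturb (A : Fin d → ℝ → ℝ) (m : Fin d) (e : ℝ → ℝ) (δ : ℝ) : Fin d → ℝ → ℝ :=
  A + Pi.single m (δ • e)

theorem perturb_self (x : ℝ) (δ : ℝ) : perturb A m e δ m x = A m x + δ * e x := by
  simp [perturb]

theorem perturb_of_ne {j : Fin d} (h : j ≠ m) (δ : ℝ) : perturb A m e δ j = A j := by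
  simp [perturb, h]

theorem perturb_eq (δ : ℝ) (j : Fin d) :
    perturb A m e δ j = fun x => A j x + δ * ((Pi.single m e : Fin d → ℝ → ℝ) j x) := by
  ext x
  rcases eq_or_ne j m with rfl | h
  · simp [perturb]
  · simp [perturb, h]

theorem contDiff_piSingle (he : ContDiff ℝ (⊤ : ℕ∞) e) (j : Fin d) :
    ContDiff ℝ (⊤ : ℕ∞) ((Pi.single m e : Fin d → ℝ → ℝ) j) := by
  rcases eq_or_ne j m with rfl | h
  · simpa
  · rw [Pi.single_eq_of_ne h]
    exact contDiff_const

theorem contDiff_perturb (hA : ∀ j, ContDiff ℝ (⊤ : ℕ∞) (A j)) (he : ContDiff ℝ (⊤ : ℕ∞) e)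
    (δ : ℝ) (j : Fin d) : ContDiff ℝ (⊤ : ℕ∞) (perturb A m e δ j) := by
  rw [perturb_eq]
  exact (hA j).add (contDiff_const.mul (contDiff_piSingle he j))

theorem twistHam_perturb (δ : ℝ) (p : Ph d) :
    twistHam (perturb A m e δ) s p = twistHam A s p + δ * (e (actJ s p) * actJ m p) := by
  simp only [twistHam, perturb_eq, add_mul, Finset.sum_add_distrib]
  congr 1
  rw [Finset.sum_eq_single m (fun j _ h => by simp [h]) (by simp)]
  simp [mul_assoc]

theorem twistFreq_perturb (hA : ∀ j, ContDiff ℝ (⊤ : ℕ∞) (A j)) (he : ContDiff ℝ (⊤ : ℕ∞) e)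
    (δ : ℝ) (p : Ph d) :
    twistFreq (perturb A m e δ) s p =
      twistFreq A s p + δ • twistFreq (Pi.single m e : Fin d → ℝ → ℝ) s p := by
  have h (l : Fin d) : deriv (perturb A m e δ l) (actJ s p) =
      deriv (A l) (actJ s p) + δ * deriv ((Pi.single m e : Fin d → ℝ → ℝ) l) (actJ s p) := by
    have h1 := (contDiff_piSingle (m := m) he l).differentiable (by simp) (actJ s p)
    rw [perturb_eq, deriv_fun_add ((hA l).differentiable (by simp) _) (h1.const_mul δ),
      deriv_const_mul_field]
  have hsum : ∑ l, deriv (perturb A m e δ l) (actJ s p) * actJ l p =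
      ∑ l, deriv (A l) (actJ s p) * actJ l p +
        δ * ∑ l, deriv ((Pi.single m e : Fin d → ℝ → ℝ) l) (actJ s p) * actJ l p := by
    simp only [h, add_mul, mul_assoc, Finset.sum_add_distrib, ← Finset.mul_sum]
  ext i
  simp only [twistFreq, hsum, congrFun (perturb_eq δ i), Pi.add_apply, Pi.smul_apply, smul_eq_mul,
    Pi.single_apply s]
  split_ifs <;> ring

theorem IsClose.trans {n : ℕ} {T e₁ e₂ : ℝ} {H₁ H₂ H₃ : Ph d → ℝ} {φ₁ φ₂ φ₃ : ℝ → Ph d → Ph d}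
    (h₁ : ContDiff ℝ (⊤ : ℕ∞) H₁) (h₂ : ContDiff ℝ (⊤ : ℕ∞) H₂) (h₃ : ContDiff ℝ (⊤ : ℕ∞) H₃)
    (h : IsClose n T e₁ H₁ H₂ φ₁ φ₂) (h' : IsClose n T e₂ H₂ H₃ φ₂ φ₃) :
    IsClose n T (e₁ + e₂) H₁ H₃ φ₁ φ₃ where
  ham R hR k hk p := by
    have heq : (fun p => ballBump d R p * (H₃ p - H₁ p)) =
        (fun p => ballBump d R p * (H₂ p - H₁ p)) + fun p => ballBump d R p * (H₃ p - H₂ p) := by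
      ext p; simp only [Pi.add_apply]; ring
    have hs {F G : Ph d → ℝ} (hF : ContDiff ℝ (⊤ : ℕ∞) F) (hG : ContDiff ℝ (⊤ : ℕ∞) G) :
        ContDiff ℝ k fun p => ballBump d R p * (F p - G p) :=
      ((ballBump d R).contDiff.mul (hF.sub hG)).of_le (by exact_mod_cast le_top (a := (k : ℕ∞)))
    rw [heq, iteratedFDeriv_add_apply (hs h₂ h₁).contDiffAt (hs h₃ h₂).contDiffAt]
    exact (norm_add_le _ _).trans (add_le_add (h.ham R hR k hk p) (h'.ham R hR k hk p))
  flat := h'.flat.trans h.flat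
  flow t p ht hp := (dist_triangle _ _ _).trans (add_le_add (h.flow t p ht hp) (h'.flow t p ht hp))

theorem eventually_isClose_perturb (hA : ∀ j, ContDiff ℝ (⊤ : ℕ∞) (A j))
    (he : ContDiff ℝ (⊤ : ℕ∞) e) (he0 : e =ᶠ[𝓝 0] 0) (hΦ : IsSymplecto Φ) (hΦ0 : Φ.symm 0 = 0)
    (n : ℕ) (T : ℝ) {ε : ℝ} (hε : 0 < ε) :
    ∀ᶠ δ in 𝓝 (0 : ℝ), IsClose n T ε (conjHam A s Φ) (conjHam (perturb A m e δ) s Φ)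
      (conjFlow A s Φ) (conjFlow (perturb A m e δ) s Φ) := by
  set u : Ph d → ℝ := fun p => e (actJ s (Φ.symm p)) * actJ m (Φ.symm p) with hu
  have hus : ContDiff ℝ (⊤ : ℕ∞) u :=
    (he.comp ((contDiff_actJ s).comp hΦ.smooth_symm)).mul ((contDiff_actJ m).comp hΦ.smooth_symm)
  have hΦc := hΦ.smooth_symm.continuous
  have hdiff (δ : ℝ) (p : Ph d) :
      conjHam (perturb A m e δ) s Φ p = conjHam A s Φ p + δ * u p :=
    twistHam_perturb δ _
  have hham : ∀ᶠ δ in 𝓝 (0 : ℝ), ∀ R ≤ n, ∀ k ≤ n, ∀ p, ‖iteratedFDeriv ℝ k (fun p =>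
      ballBump d R p * (conjHam (perturb A m e δ) s Φ p - conjHam A s Φ p)) p‖ ≤ ε := by
    refine (eventually_all_finite (finite_le_nat n)).2 fun R _ =>
      (eventually_all_finite (finite_le_nat n)).2 fun k _ => ?_
    have hk : ContDiff ℝ k fun p => ballBump d R p * u p :=
      ((ballBump d R).contDiff.mul hus).of_le (by exact_mod_cast le_top (a := (k : ℕ∞)))
    obtain ⟨C, hC⟩ := (hk.continuous_iteratedFDeriv le_rfl).bounded_above_of_compact_support
      ((ballBump d R).hasCompactSupport.mul_right.iteratedFDeriv k)
    have hlim : Tendsto (fun δ : ℝ => ‖δ‖ * C) (𝓝 0) (𝓝 0) := by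
      simpa using (tendsto_norm_zero (E := ℝ)).mul_const C
    filter_upwards [hlim.eventually_le_const hε] with δ hδ p
    have heq : (fun p => ballBump d R p * (conjHam (perturb A m e δ) s Φ p - conjHam A s Φ p)) =
        fun p => δ • (ballBump d R p * u p) := by
      ext p; rw [hdiff, smul_eq_mul]; ring
    rw [heq, iteratedFDeriv_const_smul_apply' hk.contDiffAt, norm_smul]
    exact (mul_le_mul_of_nonneg_left (hC p) (norm_nonneg _)).trans hδ
  have hflow : ∀ᶠ δ in 𝓝 (0 : ℝ), ∀ y ∈ Icc (-T) T ×ˢ closedBall (0 : Ph d) n,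
      dist (conjFlow A s Φ y.1 y.2) (conjFlow (perturb A m e δ) s Φ y.1 y.2) < ε := by
    refine (isCompact_Icc.prod (isCompact_closedBall _ _)).eventually_forall_of_forall_eventually
      fun y _ => ?_
    have hF : Continuous fun z : ℝ × (ℝ × Ph d) =>
        conjFlow (perturb A m e z.1) s Φ z.2.1 z.2.2 := by
      have h2 : Continuous fun z : ℝ × (ℝ × Ph d) => Φ.symm z.2.2 :=
        hΦc.comp (continuous_snd.comp continuous_snd)
      simp only [conjFlow, twistFlow, twistFreq_perturb hA he]
      refine hΦ.smooth.continuous.comp (continuous_rot ?_ h2)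
      exact continuous_snd.fst.smul (((continuous_twistFreq hA).comp h2).add
        (continuous_fst.smul ((continuous_twistFreq (contDiff_piSingle he)).comp h2)))
    have hG : Continuous fun z : ℝ × (ℝ × Ph d) => conjFlow A s Φ z.2.1 z.2.2 :=
      (continuous_conjFlow hA hΦ).comp continuous_snd
    have h0 : perturb A m e 0 = A := by simp [perturb]
    refine ((hG.dist hF).tendsto (0, y)).eventually_lt_const ?_
    simpa only [h0, dist_self] using hε
  filter_upwards [hham, hflow] with δ h1 h2
  refine ⟨h1, ?_, fun t p ht hp => (h2 (t, p) ⟨abs_le.1 ht, mem_closedBall_zero_iff.2 hp⟩).le⟩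
  have h0 : Tendsto (fun p : Ph d => actJ s (Φ.symm p)) (𝓝 0) (𝓝 0) := by
    have h := ((continuous_actJ s).comp hΦc).tendsto (0 : Ph d)
    have h1 : actJ s (Φ.symm 0) = 0 := by simp [hΦ0, actJ]
    rwa [Function.comp_apply, h1] at h
  filter_upwards [h0.eventually he0] with p hp
  simp only [hdiff, hu, hp]
  simp

end Twist

section Zones

/-- The centres of the zones, two families of geometric progressions. -/
def zoneCen (z : Bool × ℤ) : ℝ := (if z.1 then 3 / 2 else 1) * 2 ^ z.2

theorem zoneCen_pos (z : Bool × ℤ) : 0 < zoneCen z := by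
  unfold zoneCen
  split_ifs <;> positivity

theorem exists_zone {x : ℝ} (hx : 0 < x) : ∃ z, |x - zoneCen z| ≤ zoneCen z / 4 := by
  obtain ⟨l, hl, hl'⟩ := exists_mem_Ico_zpow hx (one_lt_two (α := ℝ))
  rw [zpow_add_one₀ two_ne_zero] at hl'
  rcases le_total x (5 / 4 * 2 ^ l) with h | h
  · refine ⟨(false, l), ?_⟩
    simp only [zoneCen, Bool.false_eq_true, if_false]
    rw [abs_le]
    constructor <;> linarith
  rcases le_total x (7 / 4 * 2 ^ l) with h' | h'
  · refine ⟨(true, l), ?_⟩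
    simp only [zoneCen, if_true]
    rw [abs_le]
    constructor <;> linarith
  · refine ⟨(false, l + 1), ?_⟩
    simp only [zoneCen, Bool.false_eq_true, if_false]
    rw [zpow_add_one₀ two_ne_zero, abs_le]
    constructor <;> linarith

theorem two_mul_zoneCen_le {z z' : Bool × ℤ} (h1 : z.1 = z'.1) (h2 : z.2 < z'.2) :
    2 * zoneCen z ≤ zoneCen z' := by
  have : (2 : ℝ) ^ z.2 * 2 ≤ 2 ^ z'.2 := by
    rw [← zpow_add_one₀ two_ne_zero]
    exact zpow_le_zpow_right₀ one_le_two h2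
  unfold zoneCen
  rw [h1]
  split_ifs <;> linarith

theorem zone_separated {z z' : Bool × ℤ} (h1 : z.1 = z'.1) (hne : z ≠ z') {x : ℝ}
    (hx : |x - zoneCen z| ≤ 31 / 100 * zoneCen z) : 8 / 25 * zoneCen z' ≤ |x - zoneCen z'| := by
  rw [abs_le] at hx
  have hz := zoneCen_pos z
  have hz' := zoneCen_pos z'
  rcases lt_trichotomy z.2 z'.2 with h | h | h
  · have := two_mul_zoneCen_le h1 h
    exact le_abs.2 (Or.inr (by linarith))
  · exact absurd (Prod.ext h1 h) hne
  · have := two_mul_zoneCen_le h1.symm h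
    exact le_abs.2 (Or.inl (by linarith))

/-- A bump function equal to one on a zone. -/
def zoneBump (z : Bool × ℤ) : ContDiffBump (zoneCen z) :=
  ⟨31 / 100 * zoneCen z, 8 / 25 * zoneCen z, by have := zoneCen_pos z; positivity, by
    have := zoneCen_pos z; linarith⟩

theorem zoneBump_eq_one {z : Bool × ℤ} {x : ℝ} (hx : |x - zoneCen z| ≤ 31 / 100 * zoneCen z) :
    zoneBump z x = 1 :=
  (zoneBump z).one_of_mem_closedBall (by rw [mem_closedBall, Real.dist_eq]; exact hx)

theorem zoneBump_eq_zero {z : Bool × ℤ} {x : ℝ} (hx : 8 / 25 * zoneCen z ≤ |x - zoneCen z|) :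
    zoneBump z x = 0 :=
  (zoneBump z).zero_of_le_dist (by rw [Real.dist_eq]; exact hx)

theorem zoneBump_eventuallyEq_zero (z : Bool × ℤ) : zoneBump z =ᶠ[𝓝 (0 : ℝ)] 0 := by
  have hz := zoneCen_pos z
  filter_upwards [eventually_lt_nhds (by linarith : (0 : ℝ) < zoneCen z / 2)] with x hx
  exact zoneBump_eq_zero (le_abs.2 (Or.inr (by linarith)))

theorem zoneBump_const (z : Bool × ℤ) {z' : Bool × ℤ} (h1 : z'.1 = z.1) {x : ℝ}
    (hx : |x - zoneCen z'| ≤ 31 / 100 * zoneCen z') :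
    zoneBump z x = zoneBump z (zoneCen z') := by
  have hz := zoneCen_pos z'
  have hc : |zoneCen z' - zoneCen z'| ≤ 31 / 100 * zoneCen z' := by
    rw [sub_self, abs_zero]; positivity
  rcases eq_or_ne z' z with rfl | hne
  · rw [zoneBump_eq_one hx, zoneBump_eq_one hc]
  · rw [zoneBump_eq_zero (zone_separated h1 hne hx), zoneBump_eq_zero (zone_separated h1 hne hc)]

end Zones

/-- A number near a given one which is in nonzero rational ratio with `ω`. -/
theorem exists_resonant {ω : ℝ} (hω : ω ≠ 0) (x : ℝ) {P : ℝ → Prop} (hP : ∀ᶠ δ in 𝓝 0, P δ) :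
    ∃ δ, P δ ∧ ∃ (a b : ℕ) (ε : ℝ), 0 < a ∧ 0 < b ∧ (ε = 1 ∨ ε = -1) ∧
      a * ω + ε * b * (x + δ) = 0 := by
  have hcont : Tendsto (fun q : ℝ => q * ω - x) (𝓝 (x / ω)) (𝓝 0) := by
    have h : Continuous fun q : ℝ => q * ω - x := by fun_prop
    simpa [div_mul_cancel₀ x hω] using h.tendsto (x / ω)
  have hdense : Dense (range ((↑) : ℚ → ℝ) \ {0}) :=
    Dense.sdiff_singleton Rat.denseRange_cast 0
  obtain ⟨-, hq, ⟨q, rfl⟩, hq0⟩ := mem_closure_iff_nhds.1 (hdense (x / ω)) _ (hcont.eventually hP)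
  have hq0' : q.num ≠ 0 := by
    rintro h
    exact hq0 (by simp [Rat.num_eq_zero.1 h])
  have hcast : (q : ℝ) * q.den = q.num := by exact_mod_cast Rat.mul_den_eq_num q
  refine ⟨q * ω - x, hq, q.num.natAbs, q.den, -(q.num.sign : ℝ), Int.natAbs_pos.2 hq0', q.den_pos,
    ?_, ?_⟩
  · rcases lt_or_gt_of_ne hq0' with h | h
    · left; simp [Int.sign_eq_neg_one_of_neg h]
    · right; simp [Int.sign_eq_one_of_pos h]
  · have h1 : ((q.num.natAbs : ℕ) : ℝ) = q.num.sign * q.num := by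
      rw [Nat.cast_natAbs]; exact_mod_cast (Int.sign_mul_self_eq_abs q.num).symm
    rw [h1]
    linear_combination (-(q.num.sign : ℝ) * ω) * hcast

/-- A rotating complex number reaches a prescribed half imaginary axis. -/
theorem exists_rotation_time {κ : ℝ} (hκ : κ ≠ 0) (w : ℂ) {σ : ℝ} (hσ : σ = 1 ∨ σ = -1) :
    ∃ t : ℝ, |t| ≤ 2 * Real.pi / |κ| ∧
      (Complex.exp (-(t * κ : ℝ) * Complex.I) * w).re = 0 ∧
      0 ≤ σ * (Complex.exp (-(t * κ : ℝ) * Complex.I) * w).im := by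
  refine ⟨(w.arg - σ * (Real.pi / 2)) / κ, ?_, ?_⟩
  · rw [abs_div]
    gcongr
    have h1 := Complex.neg_pi_lt_arg w
    have h2 := Complex.arg_le_pi w
    have := Real.pi_pos
    rw [abs_le]
    rcases hσ with rfl | rfl <;> constructor <;> linarith
  · rw [div_mul_cancel₀ _ hκ]
    have h : Complex.exp (-((w.arg - σ * (Real.pi / 2) : ℝ) : ℂ) * Complex.I) * w =
        ‖w‖ * Complex.exp ((σ * (Real.pi / 2) : ℝ) * Complex.I) := by
      conv_lhs => rhs; rw [← Complex.norm_mul_exp_arg_mul_I w]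
      rw [mul_left_comm, ← Complex.exp_add]
      congr 2
      push_cast
      ring
    have h1 : (Complex.exp ((σ * (Real.pi / 2) : ℝ) * Complex.I)).re = 0 := by
      rw [Complex.exp_ofReal_mul_I_re]
      rcases hσ with rfl | rfl <;> simp
    have h2 : (Complex.exp ((σ * (Real.pi / 2) : ℝ) * Complex.I)).im = σ := by
      rw [Complex.exp_ofReal_mul_I_im]
      rcases hσ with rfl | rfl <;> simp
    rw [h, Complex.re_ofReal_mul, Complex.im_ofReal_mul, h1, h2]
    exact ⟨mul_zero _, by rw [mul_left_comm]; exact mul_nonneg (norm_nonneg _) (mul_self_nonneg σ)⟩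

section Stage

variable {d : ℕ} {ω₀ : Fin d → ℝ} {o s : Fin d} {mode : Bool → Fin d} {A : Fin d → ℝ → ℝ}
  {Φ : Equiv.Perm (Ph d)} {η : ℝ}

/-- The properties of the integrable frequencies `A` and of the conjugation `Φ` which are kept
along the construction. -/
structure IsStage (ω₀ : Fin d → ℝ) (o s : Fin d) (mode : Bool → Fin d) (A : Fin d → ℝ → ℝ)
    (Φ : Equiv.Perm (Ph d)) (η : ℝ) : Prop where
  smooth : ∀ j, ContDiff ℝ (⊤ : ℕ∞) (A j)
  freq : ∀ x, A o x = ω₀ o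
  const : ∀ z x, |x - zoneCen z| ≤ 31 / 100 * zoneCen z → A (mode z.1) x = A (mode z.1) (zoneCen z)
  symp : IsSymplecto Φ
  act : ∀ p, actJ s (Φ p) = actJ s p
  pos : 0 < η
  fix : ∀ p ∈ escSet d η, Φ p = p

namespace IsStage

theorem symm_zero (h : IsStage ω₀ o s mode A Φ η) : Φ.symm 0 = 0 := by
  rw [Equiv.symm_apply_eq]
  exact (h.fix 0 (Or.inl ⟨o, by simpa [actJ] using h.pos⟩)).symm

theorem perturb (h : IsStage ω₀ o s mode A Φ η) (hmode : Function.Injective mode)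
    (ho : ∀ b, mode b ≠ o) (z : Bool × ℤ) (δ : ℝ) :
    IsStage ω₀ o s mode (perturb A (mode z.1) (zoneBump z) δ) Φ η where
  smooth := contDiff_perturb h.smooth (zoneBump z).contDiff δ
  freq x := by rw [perturb_of_ne (ho _).symm, h.freq]
  const z' x hx := by
    rcases eq_or_ne (mode z'.1) (mode z.1) with heq | hne
    · have hc := h.const z' x hx
      rw [heq] at hc ⊢
      rw [perturb_self, perturb_self, hc, zoneBump_const z (hmode heq) hx]
    · rw [perturb_of_ne hne, h.const z' x hx]
  symp := h.symp
  act := h.act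
  pos := h.pos
  fix := h.fix

theorem deriv_mode (h : IsStage ω₀ o s mode A Φ η) {z : Bool × ℤ} {x : ℝ}
    (hx : |x - zoneCen z| < 31 / 100 * zoneCen z) : deriv (A (mode z.1)) x = 0 := by
  have : A (mode z.1) =ᶠ[𝓝 x] fun _ => A (mode z.1) (zoneCen z) := by
    have hc : Continuous fun y => |y - zoneCen z| := by fun_prop
    filter_upwards [hc.continuousAt.eventually_lt continuousAt_const hx] with y hy
    exact h.const z y hy.le
  rw [this.deriv_eq, deriv_const]

/-- A symplectic map which commutes with the resonant rotations leaves invariant an integrable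
Hamiltonian which is resonant on the zone containing its support. -/
theorem conj_mul_eq (h : IsStage ω₀ o s mode A Φ η) {z : Bool × ℤ} (hso : s ≠ o)
    (hsm : s ≠ mode z.1) {α β : ℝ} (hres : α * ω₀ o + β * A (mode z.1) (zoneCen z) = 0)
    {g : Equiv.Perm (Ph d)} (hsupp : ∀ p, 3 / 10 * zoneCen z < |actJ s p - zoneCen z| → g p = p)
    (hrot : ∀ τ : Fin d → ℝ, α * τ o + β * τ (mode z.1) = 0 → ∀ p, g (rot τ p) = rot τ (g p))
    (hact : ∀ ν : Fin d → ℝ, α * ν o + β * ν (mode z.1) = 0 →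
      ∀ p, ∑ j, ν j * actJ j (g p) = ∑ j, ν j * actJ j p) :
    conjHam A s (Φ * g) = conjHam A s Φ ∧ conjFlow A s (Φ * g) = conjFlow A s Φ := by
  have hz := zoneCen_pos z
  have hs (p : Ph d) : actJ s (g p) = actJ s p := by
    simpa [Pi.single_apply] using hact (Pi.single s 1) (by simp [hso.symm, hsm.symm]) p
  have hham (p : Ph d) : twistHam A s (g p) = twistHam A s p := by
    rcases lt_or_ge (3 / 10 * zoneCen z) |actJ s p - zoneCen z| with hp | hp
    · rw [hsupp p hp]
    · simp only [twistHam, hs]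
      refine hact (fun j => A j (actJ s p)) ?_ p
      rw [h.freq, h.const z _ (by linarith), hres]
  have hflow (t : ℝ) (p : Ph d) : g (twistFlow A s t p) = twistFlow A s t (g p) := by
    rcases lt_or_ge (3 / 10 * zoneCen z) |actJ s p - zoneCen z| with hp | hp
    · rw [hsupp p hp, hsupp _ (by rwa [actJ_twistFlow])]
    · have hfreq : twistFreq A s (g p) = twistFreq A s p := by
        simp only [twistFreq, hs]
        congr 2
        refine hact (fun j => deriv (A j) (actJ s p)) ?_ p
        rw [funext h.freq, deriv_const, h.deriv_mode (by linarith), mul_zero, mul_zero, add_zero]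
      rw [twistFlow, twistFlow, hfreq]
      refine hrot _ ?_ p
      simp only [twistFreq, Pi.smul_apply, Pi.add_apply, Pi.single_eq_of_ne hso.symm,
        Pi.single_eq_of_ne hsm.symm, smul_eq_mul, add_zero, h.freq]
      rw [h.const z (actJ s p) (by linarith)]
      linear_combination t * hres
  have hsymm (p : Ph d) : g ((Φ * g).symm p) = Φ.symm p := by
    rw [Equiv.eq_symm_apply]
    exact (Φ * g).apply_symm_apply p
  constructor
  · funext p
    have := hham ((Φ * g).symm p)
    rw [hsymm] at this
    exact this.symm
  · funext t p
    have := hflow t ((Φ * g).symm p)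
    rw [hsymm] at this
    rw [conjFlow, Equiv.Perm.mul_apply, this, conjFlow]

/-- One step of the construction: after an arbitrarily small modification, all the points of a
given zone visit the escaping set in bounded time. -/
theorem exists_next (h : IsStage ω₀ o s mode A Φ η) (hω : ω₀ o ≠ 0) (hso : s ≠ o)
    (hmode : Function.Injective mode) (ho : ∀ b, mode b ≠ o) (hs : ∀ b, s ≠ mode b)
    (z : Bool × ℤ) (n : ℕ) (T : ℝ) {e v : ℝ} (he : 0 < e) (hv : 0 < v) (hvη : v ≤ η) :
    ∃ A' Φ', IsStage ω₀ o s mode A' Φ' (v / 2) ∧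
      IsClose n T e (conjHam A s Φ) (conjHam A' s Φ') (conjFlow A s Φ) (conjFlow A' s Φ') ∧
      ∃ T', ∀ p, |actJ s p - zoneCen z| ≤ zoneCen z / 4 →
        ∃ t, |t| ≤ T' ∧ conjFlow A' s Φ' t p ∈ escSet d v := by
  have hz := zoneCen_pos z
  have he0 := zoneBump_eventuallyEq_zero z
  have hes : ContDiff ℝ (⊤ : ℕ∞) (zoneBump z) := (zoneBump z).contDiff
  have hone {x : ℝ} (hx : |x - zoneCen z| ≤ 31 / 100 * zoneCen z) := zoneBump_eq_one hx
  have hcen : |zoneCen z - zoneCen z| ≤ 31 / 100 * zoneCen z := by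
    rw [sub_self, abs_zero]; positivity
  obtain ⟨δ₁, hδ₁, a, b, ε, ha, hb, hε, hres⟩ := exists_resonant hω (A (mode z.1) (zoneCen z))
    (eventually_isClose_perturb (s := s) (m := mode z.1) h.smooth hes he0 h.symp h.symm_zero n T
      (half_pos he))
  have h₁ := h.perturb hmode ho z δ₁
  set A₁ := _root_.perturb A (mode z.1) (zoneBump z) δ₁
  have hA₁ : A₁ (mode z.1) (zoneCen z) = A (mode z.1) (zoneCen z) + δ₁ := by
    exact (perturb_self _ _).trans (by rw [hone hcen, mul_one])
  rw [← hA₁] at hres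
  obtain ⟨g, hg, hgfix, hgsupp, hgrot, hgact, hgpush⟩ :=
    exists_pusher (ho z.1) hso (hs z.1) (b := b) ha hε hv hz
  obtain ⟨hham, hflow⟩ := h₁.conj_mul_eq hso (hs z.1) hres hgsupp hgrot hgact
  have hgs (p : Ph d) : actJ s (g p) = actJ s p := by
    simpa [Pi.single_apply] using hgact (Pi.single s 1) (by simp [hso.symm, (hs z.1).symm]) p
  have hstage : IsStage ω₀ o s mode A₁ (Φ * g) (v / 2) :=
    { smooth := h₁.smooth
      freq := h₁.freq
      const := h₁.const
      symp := h.symp.mul hg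
      act := fun p => by rw [Equiv.Perm.mul_apply, h.act, hgs]
      pos := half_pos hv
      fix := fun p hp => by
        rw [Equiv.Perm.mul_apply, hgfix p hp]
        exact h.fix p (escSet_mono (half_pos hv) (by linarith) hp) }
  have hev := eventually_isClose_perturb (s := s) (m := mode z.1) hstage.smooth hes he0
    hstage.symp hstage.symm_zero n T (half_pos he)
  obtain ⟨δ₂, hδ₂, hδ₂0⟩ := ((hev.filter_mono nhdsWithin_le_nhds).and
    (self_mem_nhdsWithin (s := {0}ᶜ) (a := (0 : ℝ)))).exists
  have h₂ := hstage.perturb hmode ho z δ₂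
  refine ⟨_, _, h₂, ?_, ?_⟩
  · rw [hham, hflow] at hδ₂
    have := hδ₁.trans (contDiff_conjHam h.smooth h.symp) (contDiff_conjHam h₁.smooth h₁.symp)
      (contDiff_conjHam h₂.smooth h₂.symp) hδ₂
    rwa [add_halves] at this
  have hε0 : ε ≠ 0 := by rcases hε with rfl | rfl <;> norm_num
  have hκ : ε * b * δ₂ ≠ 0 := mul_ne_zero (mul_ne_zero hε0 (by positivity)) hδ₂0
  refine ⟨2 * Real.pi / |ε * b * δ₂|, fun p hp => ?_⟩
  set q := (Φ * g).symm p with hq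
  have hqs : actJ s q = actJ s p := by rw [← hstage.act q, hq, Equiv.apply_symm_apply]
  rw [← hqs] at hp
  obtain ⟨σ, hσ, hpush⟩ := hgpush q hp
  obtain ⟨t, ht, hre, him⟩ := exists_rotation_time hκ (resMon o (mode z.1) a b ε q) hσ
  refine ⟨t, ht, ?_⟩
  set A₂ := _root_.perturb A₁ (mode z.1) (zoneBump z) δ₂
  have hmon : resMon o (mode z.1) a b ε (twistFlow A₂ s t q) =
      Complex.exp (-(t * (ε * b * δ₂) : ℝ) * Complex.I) * resMon o (mode z.1) a b ε q := by
    rw [twistFlow, resMon_rot hε]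
    congr 4
    simp only [twistFreq, Pi.smul_apply, Pi.add_apply, Pi.single_eq_of_ne hso.symm,
      Pi.single_eq_of_ne (hs z.1).symm, smul_eq_mul, add_zero, h₂.freq]
    have hA₂ : A₂ (mode z.1) (actJ s q) = A₁ (mode z.1) (zoneCen z) + δ₂ :=
      (perturb_self _ _).trans
        (by rw [hone (by linarith), h₁.const z (actJ s q) (by linarith), mul_one])
    rw [hA₂]
    congr 1
    linear_combination t * hres
  have hesc : g (twistFlow A₂ s t q) ∈ escSet d v :=
    hpush _ (fun j => actJ_twistFlow j t q) (by rw [hmon]; exact hre) (by rw [hmon]; exact him)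
  rw [conjFlow, Equiv.Perm.mul_apply, h.fix _ (escSet_mono hv hvη hesc)]
  exact hesc

end IsStage

end Stage

/-- The points near a compact set away from the axes do not escape. -/
theorem exists_thickening_disjoint_escSet {d : ℕ} {K : Set (Ph d)} (hK : IsCompact K)
    (haxes : ∀ q ∈ K, ∀ i, actJ i q ≠ 0) :
    ∃ δ > 0, ∃ N : ℕ, ∀ n ≥ N, Disjoint (thickening δ K) (escSet d (1 / (n + 1))) := by
  let U (n : ℕ) : Set (Ph d) := (⋂ i, {q | 1 / ((n : ℝ) + 1) < actJ i q}) ∩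
    {q | ∑ i, actJ i q < n + 1}
  have hUo (n : ℕ) : IsOpen (U n) :=
    (isOpen_iInter_of_finite fun i => isOpen_lt continuous_const (continuous_actJ i)).inter
      (isOpen_lt (continuous_finsetSum _ fun i _ => continuous_actJ i) continuous_const)
  have hUmono : Monotone U := by
    intro n n' hn q hq
    simp only [U, mem_inter_iff, mem_iInter, mem_ofPred_eq] at hq ⊢
    have hn' : (n : ℝ) ≤ n' := by exact_mod_cast hn
    exact ⟨fun i => (one_div_le_one_div_of_le (by positivity) (by linarith)).trans_lt (hq.1 i),
      by linarith [hq.2]⟩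
  have hcover : K ⊆ ⋃ n, U n := by
    intro q hq
    have h1 : ∀ᶠ n : ℕ in atTop, ∀ i, 1 / ((n : ℝ) + 1) < actJ i q :=
      eventually_all.2 fun i => tendsto_one_div_add_atTop_nhds_zero_nat.eventually_lt_const
        ((actJ_nonneg i q).lt_of_ne' (haxes q hq i))
    have h2 : ∀ᶠ n : ℕ in atTop, ∑ i, actJ i q < n :=
      tendsto_natCast_atTop_atTop.eventually_gt_atTop _
    obtain ⟨n, hn1, hn2⟩ := (h1.and h2).exists
    exact mem_iUnion.2 ⟨n, mem_iInter.2 hn1, hn2.trans (lt_add_one _)⟩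
  obtain ⟨N, hN⟩ := hK.elim_directed_cover U hUo hcover hUmono.directed_le
  obtain ⟨δ, hδ, hsub⟩ := hK.exists_thickening_subset_open (hUo N) hN
  refine ⟨δ, hδ, N, fun n hn => Set.disjoint_left.2 fun q hq => ?_⟩
  have h := hUmono hn (hsub hq)
  simp only [U, mem_inter_iff, mem_iInter, mem_ofPred_eq] at h
  rw [notMem_escSet, one_div_one_div]
  exact ⟨fun i => (h.1 i).le, h.2.le⟩

/-- A flow approximated by flows moving the points of every zone infinitely often, closer and closer
to the axes or to infinity, has no compact invariant set away from the axes. -/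
theorem not_exists_invariant {d : ℕ} (s : Fin d) {φ : ℕ → ℝ → Ph d → Ph d} {ψ : ℝ → Ph d → Ph d}
    {T : ℕ → ℝ} (hlim : ∀ n t p, |t| ≤ T n → ‖p‖ ≤ n → dist (φ n t p) (ψ t p) ≤ 2 * (1 / 2) ^ n)
    {zone : ℕ → Bool × ℤ} (hzone : ∀ z N, ∃ n ≥ N, zone n = z)
    (hesc : ∀ n p, |actJ s p - zoneCen (zone n)| ≤ zoneCen (zone n) / 4 →
      ∃ t, |t| ≤ T (n + 1) ∧ φ (n + 1) t p ∈ escSet d (1 / (n + 1))) :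
    ¬ ∃ K : Set (Ph d), K.Nonempty ∧ IsCompact K ∧
      K ∩ {q : Ph d | ∃ i, actJ i q = 0} = ∅ ∧ ∀ t : ℝ, ψ t '' K ⊆ K := by
  rintro ⟨K, ⟨p, hp⟩, hK, haxes, hinv⟩
  have haxes' : ∀ q ∈ K, ∀ i, actJ i q ≠ 0 := fun q hq i h0 =>
    (haxes.subset ⟨hq, i, h0⟩ : q ∈ (∅ : Set (Ph d)))
  obtain ⟨δ, hδ, N, hN⟩ := exists_thickening_disjoint_escSet hK haxes'
  obtain ⟨z, hz⟩ := exists_zone ((actJ_nonneg s p).lt_of_ne' (haxes' p hp s))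
  have h1 : ∀ᶠ n : ℕ in atTop, 2 * (1 / 2 : ℝ) ^ n < δ := by
    have := (tendsto_pow_atTop_nhds_zero_of_lt_one (r := (1 / 2 : ℝ)) (by norm_num)
      (by norm_num)).const_mul 2
    rw [mul_zero] at this
    exact this.eventually_lt_const hδ
  have h2 : ∀ᶠ n : ℕ in atTop, ‖p‖ ≤ n := tendsto_natCast_atTop_atTop.eventually_ge_atTop _
  obtain ⟨M, hM⟩ := eventually_atTop.1 ((h1.and h2).and (eventually_ge_atTop N))
  obtain ⟨n, hn, rfl⟩ := hzone z M
  obtain ⟨t, ht, hmem⟩ := hesc n p hz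
  obtain ⟨⟨hsmall, hnorm⟩, -⟩ := hM (n + 1) (by omega)
  refine Set.disjoint_left.1 (hN n (hM n hn).2) ?_ hmem
  exact mem_thickening_iff.2
    ⟨ψ t p, hinv t ⟨p, hp, rfl⟩, (hlim (n + 1) t p ht hnorm).trans_lt hsmall⟩

section Construction

variable {d : ℕ} {ω₀ : Fin d → ℝ} {o s : Fin d} {mode : Bool → Fin d}

theorem isStage_const (ω₀ : Fin d → ℝ) (o s : Fin d) (mode : Bool → Fin d) :
    IsStage ω₀ o s mode (fun j _ => ω₀ j) 1 1 where
  smooth _ := contDiff_const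
  freq _ := rfl
  const _ _ _ := rfl
  symp := .one
  act _ := rfl
  pos := one_pos
  fix _ _ := rfl

/-- The sequence of approximations obtained by visiting successively the given zones. -/
theorem exists_stages (hω : ω₀ o ≠ 0) (hso : s ≠ o) (hmode : Function.Injective mode)
    (ho : ∀ b, mode b ≠ o) (hs : ∀ b, s ≠ mode b) (zone : ℕ → Bool × ℤ) :
    ∃ (A : ℕ → Fin d → ℝ → ℝ) (Φ : ℕ → Equiv.Perm (Ph d)) (T : ℕ → ℝ),
      A 0 = (fun j _ => ω₀ j) ∧ Φ 0 = 1 ∧ T 0 = 0 ∧ Monotone T ∧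
      (∀ n, ∃ η, IsStage ω₀ o s mode (A n) (Φ n) η) ∧
      (∀ n : ℕ, IsClose n (n + T n) ((1 / 2) ^ n) (conjHam (A n) s (Φ n))
        (conjHam (A (n + 1)) s (Φ (n + 1))) (conjFlow (A n) s (Φ n))
        (conjFlow (A (n + 1)) s (Φ (n + 1)))) ∧
      ∀ n p, |actJ s p - zoneCen (zone n)| ≤ zoneCen (zone n) / 4 →
        ∃ t, |t| ≤ T (n + 1) ∧
          conjFlow (A (n + 1)) s (Φ (n + 1)) t p ∈ escSet d (1 / (n + 1)) := by
  let S := {x : (Fin d → ℝ → ℝ) × Equiv.Perm (Ph d) × ℝ //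
    ∃ η, IsStage ω₀ o s mode x.1 x.2.1 η}
  let R (n : ℕ) (x y : S) : Prop := x.1.2.2 ≤ y.1.2.2 ∧
    IsClose n (n + x.1.2.2) ((1 / 2) ^ n) (conjHam x.1.1 s x.1.2.1) (conjHam y.1.1 s y.1.2.1)
      (conjFlow x.1.1 s x.1.2.1) (conjFlow y.1.1 s y.1.2.1) ∧
    ∀ p, |actJ s p - zoneCen (zone n)| ≤ zoneCen (zone n) / 4 →
      ∃ t, |t| ≤ y.1.2.2 ∧ conjFlow y.1.1 s y.1.2.1 t p ∈ escSet d (1 / (n + 1))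
  have hnext (n : ℕ) (x : S) : ∃ y : S, R n x y := by
    obtain ⟨⟨A, Φ, T⟩, η, h⟩ := x
    have hv : 0 < min η (1 / ((n : ℝ) + 1)) := lt_min h.pos (by positivity)
    obtain ⟨A', Φ', h', hclose, T', hT'⟩ := h.exists_next hω hso hmode ho hs (zone n) n (n + T)
      (e := (1 / 2) ^ n) (by positivity) hv (min_le_left _ _)
    refine ⟨⟨⟨A', Φ', max T T'⟩, _, h'⟩, le_max_left _ _, hclose, fun p hp => ?_⟩
    obtain ⟨t, ht, hmem⟩ := hT' p hp
    exact ⟨t, ht.trans (le_max_right _ _), escSet_mono hv (min_le_right _ _) hmem⟩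
  choose next hR using hnext
  let x (n : ℕ) : S := Nat.rec ⟨(fun j _ => ω₀ j, 1, 0), 1, isStage_const ω₀ o s mode⟩ next n
  have hx (n : ℕ) : R n (x n) (x (n + 1)) := hR n (x n)
  exact ⟨fun n => (x n).1.1, fun n => (x n).1.2.1, fun n => (x n).1.2.2, rfl, rfl, rfl,
    monotone_nat_of_le_succ fun n => (hx n).1, fun n => (x n).2, fun n => (hx n).2.1,
    fun n => (hx n).2.2⟩

theorem exists_of_freq_ne_zero (hω : ω₀ o ≠ 0) (hso : s ≠ o) (hmode : Function.Injective mode)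
    (ho : ∀ b, mode b ≠ o) (hs : ∀ b, s ≠ mode b) :
    ∃ H : Ph d → ℝ, ContDiff ℝ (⊤ : ℕ∞) H ∧ IsEllipticNF ω₀ H ∧
      ∃ Φ : ℝ → Ph d → Ph d, IsGlobalFlow H Φ ∧
        ¬ ∃ K : Set (Ph d), K.Nonempty ∧ IsCompact K ∧
            K ∩ {q : Ph d | ∃ i, actJ i q = 0} = ∅ ∧
            ∀ t : ℝ, Φ t '' K ⊆ K := by
  obtain ⟨u, hu⟩ := exists_surjective_nat (Bool × ℤ)
  obtain ⟨A, Φ, T, hA0, hΦ0, hT0, hT, hstage, hclose, hesc⟩ :=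
    exists_stages hω hso hmode ho hs fun n => u n.unpair.1
  choose η hη using hstage
  obtain ⟨L, ψ, hL, hflat, hψ, hlim⟩ := exists_flow_limit
    (fun n => contDiff_conjHam (hη n).smooth (hη n).symp)
    (fun n => isGlobalFlow_conjFlow (hη n).smooth (hη n).symp)
    (fun n => continuous_conjFlow (hη n).smooth (hη n).symp) hT hT0.ge hclose
  rw [hA0, hΦ0] at hflat
  refine ⟨L, hL, hflat, ψ, hψ, not_exists_invariant s hlim (fun z N => ?_) hesc⟩
  obtain ⟨k, rfl⟩ := hu z
  exact ⟨Nat.pair k N, Nat.right_le_pair _ _, by rw [Nat.unpair_pair]⟩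

end Construction

theorem statement1 (d : ℕ) (hd : 4 ≤ d) (ω₀ : Fin d → ℝ) :
    ∃ H : Ph d → ℝ, ContDiff ℝ (⊤ : ℕ∞) H ∧ IsEllipticNF ω₀ H ∧
      ∃ Φ : ℝ → Ph d → Ph d, IsGlobalFlow H Φ ∧
        ¬ ∃ K : Set (Ph d), K.Nonempty ∧ IsCompact K ∧
            K ∩ {q : Ph d | ∃ i, actJ i q = 0} = ∅ ∧
            ∀ t : ℝ, Φ t '' K ⊆ K := by
  rcases eq_or_ne (ω₀ ⟨0, by omega⟩) 0 with h0 | h0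
  · exact exists_of_freq_eq_zero ω₀ (m := ⟨1, by omega⟩) (by simp) h0
  · refine exists_of_freq_ne_zero (s := ⟨3, by omega⟩)
      (mode := fun b => if b then ⟨1, by omega⟩ else ⟨2, by omega⟩) h0 (by simp) ?_ ?_ ?_
    · intro b b'
      cases b <;> cases b' <;> simp
    · intro b
      cases b <;> simp
    · intro b
      cases b <;> simp
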